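/- There exists a constant c > 0 depending only on a, b and β such that the following holds: for every Lipschitz function V : closure(Ω) → ℝ with a ≤ V(x) ≤ b for all x and with Lipschitz constant ‖∇V‖_∞ ≤ (β+1)a/2, and every classical solution u of problem (P_β) relative to V, one has ∫_Ω |x-x₀|^{2β} e^{u(x)} dx ≤ c. -/

import Mathlib

open MeasureTheory Real RealInnerProductSpace

noncomputable section

/-- The Euclidean plane ℝ². -/
abbrev E2 := EuclideanSpace ℝ (Fin 2)

/-- The open annulus `{x : R₂ < |x| < R₁}` centered at the origin. -/
def ann (R₂ R₁ : ℝ) : Set E2 := {x : E2 | R₂ < ‖x‖ ∧ ‖x‖ < R₁}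

/-- `Ω`, the open annulus of radii 1/2 and 1 centered at the origin. -/
def Omega : Set E2 := ann (1/2) 1

/-- The Laplacian `Δ = ∂₁₁ + ∂₂₂` on ℝ². -/
def lap (u : E2 → ℝ) (x : E2) : ℝ :=
  ∑ i : Fin 2,
    iteratedFDeriv ℝ 2 u x ![EuclideanSpace.single i 1, EuclideanSpace.single i 1]

/-- The point `r (cos θ, sin θ)` on the circle of radius `r`. -/
def circlePt (r θ : ℝ) : E2 :=
  (WithLp.equiv 2 (Fin 2 → ℝ)).symm ![r * Real.cos θ, r * Real.sin θ]

/-- Arc-length integral of `f` over the circle `C(r) = {x : |x| = r}` centered at the origin: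
`∫_{C(r)} f dσ = ∫_0^{2π} f(r cos θ, r sin θ) r dθ`. -/
def circleIntR (f : E2 → ℝ) (r : ℝ) : ℝ := ∫ θ in (0:ℝ)..(2 * π), f (circlePt r θ) * r

/-- A classical solution of problem (P): `u ∈ C²(closure Ω)`, `u = 0` on `∂Ω`, and
`-Δu = (1 + |x - x₀|^{2β}) V e^u` in `Ω`. -/
def IsSolP (β : ℝ) (x₀ : E2) (V u : E2 → ℝ) : Prop :=
  ContDiffOn ℝ 2 u (closure Omega) ∧
  (∀ x ∈ frontier Omega, u x = 0) ∧
  ∀ x ∈ Omega, -lap u x = (1 + ‖x - x₀‖ ^ (2 * β)) * V x * Real.exp (u x)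

/-- A classical solution of problem (P_β): `u ∈ C²(closure Ω)`, `u = 0` on `∂Ω`, and
`-Δu = |x - x₀|^{2β} V e^u` in `Ω`. -/
def IsSolPbeta (β : ℝ) (x₀ : E2) (V u : E2 → ℝ) : Prop :=
  ContDiffOn ℝ 2 u (closure Omega) ∧
  (∀ x ∈ frontier Omega, u x = 0) ∧
  ∀ x ∈ Omega, -lap u x = ‖x - x₀‖ ^ (2 * β) * V x * Real.exp (u x)

/-! ### Basic calculus on the plane -/

/-- Partial derivative. -/
def Dd (i : Fin 2) (f : E2 → ℝ) (x : E2) : ℝ := fderiv ℝ f x (EuclideanSpace.single i 1)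

/-- squared norm in coordinates -/
def sq2 (x : E2) : ℝ := x 0 ^ 2 + x 1 ^ 2

lemma sq2_eq (x : E2) : ‖x‖ ^ 2 = sq2 x := by
  simp [EuclideanSpace.real_norm_sq_eq, Fin.sum_univ_two, sq2]

lemma contDiff_coord {n : WithTop ℕ∞} (i : Fin 2) : ContDiff ℝ n (fun x : E2 => x i) := by
  fun_prop

lemma contDiff_sq2 {n : WithTop ℕ∞} : ContDiff ℝ n sq2 := by
  unfold sq2; fun_prop

lemma continuous_sq2 : Continuous sq2 := (contDiff_sq2 (n := 1)).continuous

lemma Dd_coord (i j : Fin 2) (x : E2) : Dd i (fun x : E2 => x j) x = if i = j then 1 else 0 := by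
  have h : HasFDerivAt (fun x : E2 => x j) (EuclideanSpace.proj j : E2 →L[ℝ] ℝ) x :=
    (EuclideanSpace.proj j : E2 →L[ℝ] ℝ).hasFDerivAt
  unfold Dd
  rw [h.fderiv]
  simp [eq_comm]

lemma Dd_mul {f g : E2 → ℝ} {x : E2} (hf : DifferentiableAt ℝ f x) (hg : DifferentiableAt ℝ g x)
    (i : Fin 2) : Dd i (fun y => f y * g y) x = f x * Dd i g x + Dd i f x * g x := by
  unfold Dd; rw [fderiv_fun_mul hf hg]; simp; ring

lemma Dd_add {f g : E2 → ℝ} {x : E2} (hf : DifferentiableAt ℝ f x) (hg : DifferentiableAt ℝ g x)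
    (i : Fin 2) : Dd i (fun y => f y + g y) x = Dd i f x + Dd i g x := by
  unfold Dd; rw [fderiv_fun_add hf hg]; simp

lemma Dd_sub {f g : E2 → ℝ} {x : E2} (hf : DifferentiableAt ℝ f x) (hg : DifferentiableAt ℝ g x)
    (i : Fin 2) : Dd i (fun y => f y - g y) x = Dd i f x - Dd i g x := by
  unfold Dd; rw [fderiv_fun_sub hf hg]; simp

lemma Dd_const (c : ℝ) (x : E2) (i : Fin 2) : Dd i (fun _ => c) x = 0 := by
  unfold Dd; simp

lemma Dd_comp {f : E2 → ℝ} {g : ℝ → ℝ} {x : E2} (hf : DifferentiableAt ℝ f x)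
    (hg : DifferentiableAt ℝ g (f x)) (i : Fin 2) :
    Dd i (fun y => g (f y)) x = deriv g (f x) * Dd i f x := by
  unfold Dd
  have := (hg.hasDerivAt.comp_hasFDerivAt x hf.hasFDerivAt).fderiv
  have h2 : (g ∘ f) = fun y => g (f y) := rfl
  rw [h2] at this
  rw [this]; simp

lemma Dd_exp {f : E2 → ℝ} {x : E2} (hf : DifferentiableAt ℝ f x) (i : Fin 2) :
    Dd i (fun y => Real.exp (f y)) x = Real.exp (f x) * Dd i f x := by
  rw [Dd_comp hf Real.differentiableAt_exp]; simp

lemma Dd_sq {f : E2 → ℝ} {x : E2} (hf : DifferentiableAt ℝ f x) (i : Fin 2) :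
    Dd i (fun y => f y ^ 2) x = 2 * f x * Dd i f x := by
  have : (fun y => f y ^ 2) = fun y => f y * f y := by ext y; ring
  rw [this, Dd_mul hf hf]; ring

lemma Dd_sq2 (x : E2) (i : Fin 2) : Dd i sq2 x = 2 * x i := by
  have h : sq2 = fun x : E2 => x 0 ^ 2 + x 1 ^ 2 := rfl
  rw [h, Dd_add (by fun_prop) (by fun_prop), Dd_sq (by fun_prop), Dd_sq (by fun_prop),
    Dd_coord, Dd_coord]
  fin_cases i <;> simp

lemma Dd_radial {g : ℝ → ℝ} (hg : Differentiable ℝ g) (x : E2) (i : Fin 2) :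
    Dd i (fun y => g (sq2 y)) x = 2 * deriv g (sq2 x) * x i := by
  rw [Dd_comp ((contDiff_sq2 (n := 1)).differentiable (by norm_num) x) (hg _), Dd_sq2]; ring

lemma Dd_congr {f g : E2 → ℝ} {x : E2} (h : f =ᶠ[nhds x] g) (i : Fin 2) : Dd i f x = Dd i g x := by
  unfold Dd; rw [h.fderiv_eq]

lemma contDiff_Dd {f : E2 → ℝ} (hf : ContDiff ℝ 2 f) (i : Fin 2) : ContDiff ℝ 1 (Dd i f) := by
  have : ContDiff ℝ 1 (fderiv ℝ f) := hf.fderiv_right (by norm_num)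
  exact this.clm_apply contDiff_const

lemma continuous_Dd {f : E2 → ℝ} (hf : ContDiff ℝ 1 f) (i : Fin 2) : Continuous (Dd i f) := by
  have : Continuous (fderiv ℝ f) := hf.continuous_fderiv (by norm_num)
  exact this.clm_apply continuous_const

lemma Dd_Dd {f : E2 → ℝ} {x : E2} (hf : ContDiffAt ℝ 2 f x) (i j : Fin 2) :
    Dd i (Dd j f) x =
      fderiv ℝ (fderiv ℝ f) x (EuclideanSpace.single i 1) (EuclideanSpace.single j 1) := by
  have h1 : DifferentiableAt ℝ (fderiv ℝ f) x :=
    (hf.fderiv_right (m := 1) (by norm_num)).differentiableAt (by norm_num)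
  unfold Dd
  rw [fderiv_clm_apply h1 (by fun_prop)]
  simp

lemma Dd_comm {f : E2 → ℝ} {x : E2} (hf : ContDiffAt ℝ 2 f x) (i j : Fin 2) :
    Dd i (Dd j f) x = Dd j (Dd i f) x := by
  rw [Dd_Dd hf, Dd_Dd hf]
  exact (hf.isSymmSndFDerivAt (by simp)).eq _ _

lemma lap_eq {f : E2 → ℝ} {x : E2} (hf : ContDiffAt ℝ 2 f x) :
    lap f x = Dd 0 (Dd 0 f) x + Dd 1 (Dd 1 f) x := by
  rw [Dd_Dd hf, Dd_Dd hf]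
  unfold lap
  simp [Fin.sum_univ_two, iteratedFDeriv_two_apply]

/-- the closed unit ball -/
def BB : Set E2 := {x | sq2 x ≤ 1}

lemma BB_eq : BB = Metric.closedBall (0 : E2) 1 := by
  ext x
  simp only [BB, Set.mem_ofPred_eq, Metric.mem_closedBall, dist_zero_right, ← sq2_eq]
  constructor
  · intro h; nlinarith [norm_nonneg x]
  · intro h; nlinarith [norm_nonneg x]

lemma isCompact_BB : IsCompact BB := by rw [BB_eq]; exact isCompact_closedBall _ _

lemma measurableSet_BB : MeasurableSet BB := isCompact_BB.measurableSet

lemma intBB {f : E2 → ℝ} (hf : Continuous f) : IntegrableOn f BB :=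
  hf.continuousOn.integrableOn_compact isCompact_BB

lemma hcs_of_zero {F : E2 → ℝ} (h0 : ∀ x, 1 < sq2 x → F x = 0) : HasCompactSupport F := by
  refine HasCompactSupport.intro isCompact_BB ?_
  intro x hx
  exact h0 x (by simpa [BB] using hx)

lemma Dd_zero_out {F : E2 → ℝ} (h0 : ∀ x, 1 < sq2 x → F x = 0) (i : Fin 2) (x : E2)
    (hx : 1 < sq2 x) : Dd i F x = 0 := by
  have : F =ᶠ[nhds x] fun _ => 0 := by
    have : {y | 1 < sq2 y} ∈ nhds x := (isOpen_lt continuous_const continuous_sq2).mem_nhds hx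
    filter_upwards [this] with y hy using h0 y hy
  rw [Dd_congr this, Dd_const]

lemma setInt_eq {F : E2 → ℝ} (h0 : ∀ x, 1 < sq2 x → F x = 0) : ∫ x in BB, F x = ∫ x, F x := by
  apply setIntegral_eq_integral_of_forall_compl_eq_zero
  intro x hx
  exact h0 x (by simpa [BB] using hx)

/-- Divergence theorem. -/
lemma int_Dd {F : E2 → ℝ} (hF : ContDiff ℝ 1 F) (h0 : ∀ x, 1 < sq2 x → F x = 0) (i : Fin 2) :
    ∫ x in BB, Dd i F x = 0 := by
  rw [setInt_eq (Dd_zero_out h0 i)]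
  have hc := hcs_of_zero h0
  have hc' := hcs_of_zero (Dd_zero_out h0 i)
  have := integral_mul_fderiv_eq_neg_fderiv_mul_of_integrable (μ := (volume : Measure E2))
    (f := fun _ => (1:ℝ)) (g := F)
    (v := EuclideanSpace.single i 1) (by simp)
    (by simp only [one_mul]; exact (continuous_Dd hF i).integrable_of_hasCompactSupport hc')
    (by simpa using hF.continuous.integrable_of_hasCompactSupport hc)
    (by intros; fun_prop) (fun x _ => hF.differentiable (by norm_num) x)
  simpa [Dd] using this

lemma int_div {F G : E2 → ℝ} (hF : ContDiff ℝ 1 F) (hF0 : ∀ x, 1 < sq2 x → F x = 0)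
    (hG : ContDiff ℝ 1 G) (hG0 : ∀ x, 1 < sq2 x → G x = 0) :
    ∫ x in BB, (Dd 0 F x + Dd 1 G x) = 0 := by
  rw [integral_add (intBB (continuous_Dd hF 0)) (intBB (continuous_Dd hG 1)), int_Dd hF hF0,
    int_Dd hG hG0, add_zero]


/-! ### Integral identities -/

lemma cd_diff {f : E2 → ℝ} (hf : ContDiff ℝ 1 f) (x : E2) : DifferentiableAt ℝ f x :=
  hf.differentiable (by norm_num) x

lemma ident_green {φ U : E2 → ℝ} (hφ : ContDiff ℝ 2 φ) (hU : ContDiff ℝ 2 U)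
    (h0 : ∀ x, 1 < sq2 x → φ x = 0) :
    ∫ x in BB, φ x * (Dd 0 (Dd 0 U) x + Dd 1 (Dd 1 U) x) =
      ∫ x in BB, U x * (Dd 0 (Dd 0 φ) x + Dd 1 (Dd 1 φ) x) := by
  have hU1 : ContDiff ℝ 1 U := hU.of_le (by norm_num)
  have hφ1 : ContDiff ℝ 1 φ := hφ.of_le (by norm_num)
  have hDU := fun i => contDiff_Dd hU i
  have hDφ := fun i => contDiff_Dd hφ i
  have key := int_div (F := fun x => φ x * Dd 0 U x - U x * Dd 0 φ x)
    (G := fun x => φ x * Dd 1 U x - U x * Dd 1 φ x)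
    ((hφ1.mul (hDU 0)).sub (hU1.mul (hDφ 0)))
    (fun x hx => by simp [h0 x hx, Dd_zero_out h0 0 x hx])
    ((hφ1.mul (hDU 1)).sub (hU1.mul (hDφ 1)))
    (fun x hx => by simp [h0 x hx, Dd_zero_out h0 1 x hx])
  have e : ∀ i x, Dd i (fun x => φ x * Dd i U x - U x * Dd i φ x) x =
      φ x * Dd i (Dd i U) x - U x * Dd i (Dd i φ) x := by
    intro i x
    rw [Dd_sub (cd_diff (hφ1.mul (hDU i)) x) (cd_diff (hU1.mul (hDφ i)) x),
      Dd_mul (cd_diff hφ1 x) (cd_diff (hDU i) x), Dd_mul (cd_diff hU1 x) (cd_diff (hDφ i) x)]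
    ring
  simp only [e] at key
  rw [← sub_eq_zero, ← integral_sub, ← key]
  · congr 1; ext x; ring
  · exact intBB (hφ1.continuous.mul
      ((continuous_Dd (hDU 0) 0).add (continuous_Dd (hDU 1) 1)))
  · exact intBB (hU1.continuous.mul
      ((continuous_Dd (hDφ 0) 0).add (continuous_Dd (hDφ 1) 1)))

lemma ident_flux {χ U : E2 → ℝ} (hχ : ContDiff ℝ 1 χ) (hU : ContDiff ℝ 2 U)
    (h0 : ∀ x, 1 < sq2 x → χ x = 0) :
    ∫ x in BB, (χ x * (Dd 0 (Dd 0 U) x + Dd 1 (Dd 1 U) x) +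
      (Dd 0 χ x * Dd 0 U x + Dd 1 χ x * Dd 1 U x)) = 0 := by
  have hDU := fun i => contDiff_Dd hU i
  have key := int_div (F := fun x => χ x * Dd 0 U x) (G := fun x => χ x * Dd 1 U x)
    (hχ.mul (hDU 0)) (fun x hx => by simp [h0 x hx])
    (hχ.mul (hDU 1)) (fun x hx => by simp [h0 x hx])
  rw [← key]
  congr 1; ext x
  rw [Dd_mul (cd_diff hχ x) (cd_diff (hDU 0) x), Dd_mul (cd_diff hχ x) (cd_diff (hDU 1) x)]
  ring

lemma ident_exp {η U : E2 → ℝ} (hη : ContDiff ℝ 1 η) (hU : ContDiff ℝ 2 U)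
    (h0 : ∀ x, 1 < sq2 x → η x = 0) :
    ∫ x in BB, (η x ^ 2 * Real.exp (U x) * (Dd 0 U x ^ 2 + Dd 1 U x ^ 2) +
      2 * η x * Real.exp (U x) * (Dd 0 η x * Dd 0 U x + Dd 1 η x * Dd 1 U x) +
      η x ^ 2 * Real.exp (U x) * (Dd 0 (Dd 0 U) x + Dd 1 (Dd 1 U) x)) = 0 := by
  have hU1 : ContDiff ℝ 1 U := hU.of_le (by norm_num)
  have key := ident_flux (χ := fun x => η x ^ 2 * Real.exp (U x))
    ((hη.pow 2).mul hU1.exp) hU (fun x hx => by simp [h0 x hx])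
  rw [← key]
  congr 1; ext x
  have e : ∀ i, Dd i (fun x => η x ^ 2 * Real.exp (U x)) x =
      η x ^ 2 * (Real.exp (U x) * Dd i U x) + 2 * η x * Dd i η x * Real.exp (U x) := by
    intro i
    rw [Dd_mul (cd_diff (hη.pow 2) x) (cd_diff hU1.exp x), Dd_sq (cd_diff hη x),
      Dd_exp (cd_diff hU1 x)]
  rw [e, e]; ring

lemma Dd_y (c : E2) (i j : Fin 2) (x : E2) :
    Dd i (fun x : E2 => x j - c j) x = if i = j then 1 else 0 := by
  rw [Dd_sub (by fun_prop) (by fun_prop), Dd_coord, Dd_const, sub_zero]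

lemma cd_y (c : E2) (j : Fin 2) {n : WithTop ℕ∞} :
    ContDiff ℝ n (fun x : E2 => x j - c j) := by fun_prop

/-- Pohozaev identity. -/
lemma ident_poho {χ U : E2 → ℝ} (c : E2) (hχ : ContDiff ℝ 1 χ) (hU : ContDiff ℝ 2 U)
    (h0 : ∀ x, 1 < sq2 x → χ x = 0) :
    ∫ x in BB, (((x 0 - c 0) * Dd 0 U x + (x 1 - c 1) * Dd 1 U x) *
        (Dd 0 χ x * Dd 0 U x + Dd 1 χ x * Dd 1 U x) -
      1 / 2 * ((x 0 - c 0) * Dd 0 χ x + (x 1 - c 1) * Dd 1 χ x) * (Dd 0 U x ^ 2 + Dd 1 U x ^ 2) +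
      χ x * (Dd 0 (Dd 0 U) x + Dd 1 (Dd 1 U) x) *
        ((x 0 - c 0) * Dd 0 U x + (x 1 - c 1) * Dd 1 U x)) = 0 := by
  have hDU := fun i => contDiff_Dd hU i
  have hy := fun j => cd_y c j (n := 1)
  set A : E2 → ℝ := fun x => (x 0 - c 0) * Dd 0 U x + (x 1 - c 1) * Dd 1 U x with hA
  set G : E2 → ℝ := fun x => Dd 0 U x ^ 2 + Dd 1 U x ^ 2 with hG
  have hA1 : ContDiff ℝ 1 A := ((hy 0).mul (hDU 0)).add ((hy 1).mul (hDU 1))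
  have hG1 : ContDiff ℝ 1 G := ((hDU 0).pow 2).add ((hDU 1).pow 2)
  have hh : ∀ i : Fin 2, ContDiff ℝ 1 (fun x => A x * Dd i U x - 1 / 2 * ((x i - c i) * G x)) :=
    fun i => (hA1.mul (hDU i)).sub (contDiff_const.mul ((hy i).mul hG1))
  have key := int_div (F := fun x => χ x * (A x * Dd 0 U x - 1 / 2 * ((x 0 - c 0) * G x)))
    (G := fun x => χ x * (A x * Dd 1 U x - 1 / 2 * ((x 1 - c 1) * G x)))
    (hχ.mul (hh 0)) (fun x hx => by simp [h0 x hx])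
    (hχ.mul (hh 1)) (fun x hx => by simp [h0 x hx])
  rw [← key]
  congr 1; ext x
  have eA : ∀ i, Dd i A x = (x 0 - c 0) * Dd i (Dd 0 U) x + (x 1 - c 1) * Dd i (Dd 1 U) x
      + Dd i U x := by
    intro i
    rw [hA, Dd_add (cd_diff ((hy 0).mul (hDU 0)) x) (cd_diff ((hy 1).mul (hDU 1)) x),
      Dd_mul (cd_diff (hy 0) x) (cd_diff (hDU 0) x), Dd_mul (cd_diff (hy 1) x) (cd_diff (hDU 1) x),
      Dd_y, Dd_y]
    fin_cases i <;> simp <;> ring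
  have eG : ∀ i, Dd i G x = 2 * Dd 0 U x * Dd i (Dd 0 U) x + 2 * Dd 1 U x * Dd i (Dd 1 U) x := by
    intro i
    rw [hG, Dd_add (cd_diff ((hDU 0).pow 2) x) (cd_diff ((hDU 1).pow 2) x),
      Dd_sq (cd_diff (hDU 0) x), Dd_sq (cd_diff (hDU 1) x)]
  have e : ∀ i, Dd i (fun x => χ x * (A x * Dd i U x - 1 / 2 * ((x i - c i) * G x))) x =
      χ x * (A x * Dd i (Dd i U) x + Dd i A x * Dd i U x -
        1 / 2 * ((x i - c i) * Dd i G x + G x)) +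
      Dd i χ x * (A x * Dd i U x - 1 / 2 * ((x i - c i) * G x)) := by
    intro i
    rw [Dd_mul (cd_diff hχ x) (cd_diff (hh i) x),
      Dd_sub (cd_diff (hA1.mul (hDU i)) x) (cd_diff (contDiff_const.mul ((hy i).mul hG1)) x),
      Dd_mul (cd_diff hA1 x) (cd_diff (hDU i) x),
      Dd_mul (cd_diff contDiff_const x) (cd_diff ((hy i).mul hG1) x),
      Dd_mul (cd_diff (hy i) x) (cd_diff hG1 x), Dd_y, Dd_const]
    simp
  rw [e, e, eA, eA, eG, eG, Dd_comm hU.contDiffAt 1 0]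
  simp only [hA, hG]
  ring

/-- Integration by parts against a Lipschitz function. -/
lemma ident_lip {V P Q M : E2 → ℝ} {L : NNReal} (hV : LipschitzWith L V)
    (hP : ContDiff ℝ 1 P) (hP0 : ∀ x, 1 < sq2 x → P x = 0)
    (hQ : ContDiff ℝ 1 Q) (hQ0 : ∀ x, 1 < sq2 x → Q x = 0)
    (hM : Continuous M) (hM0 : ∀ x ∈ BB, 0 ≤ M x)
    (hPM : ∀ x ∈ BB, P x ^ 2 + Q x ^ 2 ≤ M x ^ 2) :
    |∫ x in BB, V x * (Dd 0 P x + Dd 1 Q x)| ≤ L * ∫ x in BB, M x := by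
  have step : ∀ (i : Fin 2) (P : E2 → ℝ), ContDiff ℝ 1 P → (∀ x, 1 < sq2 x → P x = 0) →
      ∫ x in BB, V x * Dd i P x =
        - ∫ x in BB, lineDeriv ℝ V x (EuclideanSpace.single i 1) * P x := by
    intro i P hP hP0
    obtain ⟨C, hC⟩ := hP.lipschitzWith_of_hasCompactSupport (hcs_of_zero hP0) (by norm_num)
    have := hV.integral_lineDeriv_mul_eq (μ := (volume : Measure E2)) hC (hcs_of_zero hP0)
      (EuclideanSpace.single i 1)
    rw [setInt_eq (fun x hx => by rw [Dd_zero_out hP0 i x hx, mul_zero]),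
      setInt_eq (fun x hx => by rw [hP0 x hx, mul_zero])]
    have e : ∀ x, lineDeriv ℝ P x (-(EuclideanSpace.single i 1)) * V x = -(V x * Dd i P x) := by
      intro x
      rw [(cd_diff hP x).lineDeriv_eq_fderiv]; simp [Dd]; ring
    simp only [e] at this
    rw [integral_neg] at this
    rw [this]; ring
  have iP : ∀ (i : Fin 2) (P : E2 → ℝ), ContDiff ℝ 1 P → IntegrableOn (fun x => V x * Dd i P x) BB :=
    fun i P hP => intBB (hV.continuous.mul (continuous_Dd hP i))
  have iL : ∀ (i : Fin 2) (P : E2 → ℝ), ContDiff ℝ 1 P →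
      IntegrableOn (fun x => lineDeriv ℝ V x (EuclideanSpace.single i 1) * P x) BB := by
    intro i P hP
    refine (intBB hP.continuous).bdd_mul (c := L * ‖(EuclideanSpace.single i 1 : E2)‖) ?_ ?_
    · exact (measurable_lineDeriv hV.continuous).aestronglyMeasurable
    · exact Filter.Eventually.of_forall fun x => norm_lineDeriv_le_of_lipschitz ℝ hV
  simp only [mul_add]
  rw [integral_add (iP 0 P hP) (iP 1 Q hQ), step 0 P hP hP0, step 1 Q hQ hQ0, ← neg_add, abs_neg,
    ← integral_add (iL 0 P hP) (iL 1 Q hQ), ← integral_const_mul, ← Real.norm_eq_abs]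
  apply norm_integral_le_of_norm_le ((intBB hM).const_mul _)
  have hd := hV.ae_differentiableAt (μ := (volume : Measure E2))
  filter_upwards [ae_restrict_of_ae hd, ae_restrict_mem measurableSet_BB] with x hx hxB
  rw [hx.lineDeriv_eq_fderiv, hx.lineDeriv_eq_fderiv]
  have e : fderiv ℝ V x (EuclideanSpace.single 0 1) * P x +
      fderiv ℝ V x (EuclideanSpace.single 1 1) * Q x =
      fderiv ℝ V x (P x • EuclideanSpace.single 0 1 + Q x • EuclideanSpace.single 1 1) := by
    simp; ring
  rw [e]
  refine ((fderiv ℝ V x).le_opNorm _).trans ?_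
  apply mul_le_mul (norm_fderiv_le_of_lipschitz ℝ hV) _ (norm_nonneg _) L.coe_nonneg
  apply le_of_sq_le_sq _ (hM0 x hxB) |> fun h => h
  rw [sq2_eq]
  simpa [sq2] using hPM x hxB

lemma sobolev_const : ∃ K > (0:ℝ), ∀ g : E2 → ℝ, ContDiff ℝ 1 g → (∀ x, 1 < sq2 x → g x = 0) →
    ∫ x in BB, g x ^ 2 ≤ K * (∫ x in BB, (|Dd 0 g x| + |Dd 1 g x|)) ^ 2 := by
  have hfin : Module.finrank ℝ E2 = 2 := by simp
  have hconj : Real.HolderConjugate (Module.finrank ℝ E2) 2 := by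
    rw [hfin]; constructor <;> norm_num
  refine ⟨lintegralPowLePowLIntegralFDerivConst (volume : Measure E2) 2 + 1, by positivity, ?_⟩
  intro g hg h0
  have hS := lintegral_pow_le_pow_lintegral_fderiv (volume : Measure E2) hg (hcs_of_zero h0) hconj
  set K := lintegralPowLePowLIntegralFDerivConst (volume : Measure E2) 2
  have h1 : ∫ x in BB, g x ^ 2 = (∫⁻ x, ‖g x‖ₑ ^ (2:ℝ)).toReal := by
    rw [setInt_eq (fun x hx => by rw [h0 x hx]; norm_num), integral_eq_lintegral_of_nonneg_ae
      (Filter.Eventually.of_forall fun x => sq_nonneg _)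
      (hg.continuous.pow 2).aestronglyMeasurable]
    congr 1
    apply lintegral_congr
    intro x
    rw [← sq_abs, ENNReal.ofReal_pow (abs_nonneg _), Real.enorm_eq_ofReal_abs]
    norm_num
  have h2 : ∫⁻ x, ‖fderiv ℝ g x‖ₑ ≤
      ENNReal.ofReal (∫ x in BB, (|Dd 0 g x| + |Dd 1 g x|)) := by
    rw [setInt_eq (fun x hx => by rw [Dd_zero_out h0 0 x hx, Dd_zero_out h0 1 x hx]; norm_num)]
    have hc : Continuous (fun x => |Dd 0 g x| + |Dd 1 g x|) :=
      (continuous_Dd hg 0).abs.add (continuous_Dd hg 1).abs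
    rw [ofReal_integral_eq_lintegral_ofReal (hc.integrable_of_hasCompactSupport (hcs_of_zero
      (fun x hx => by rw [Dd_zero_out h0 0 x hx, Dd_zero_out h0 1 x hx]; norm_num)))
      (Filter.Eventually.of_forall fun x => by positivity)]
    apply lintegral_mono
    intro x
    simp only
    rw [← ofReal_norm]
    apply ENNReal.ofReal_le_ofReal
    apply ContinuousLinearMap.opNorm_le_bound _ (by positivity)
    intro v
    have hv : v = v 0 • EuclideanSpace.single 0 1 + v 1 • EuclideanSpace.single 1 1 := by
      ext i; fin_cases i <;> simp
    have e : fderiv ℝ g x v = v 0 * Dd 0 g x + v 1 * Dd 1 g x := by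
      conv_lhs => rw [hv]
      simp [Dd]
    rw [e, Real.norm_eq_abs]
    have hi : ∀ i, |v i| ≤ ‖v‖ := fun i => by
      simpa using PiLp.norm_apply_le v i
    calc |v 0 * Dd 0 g x + v 1 * Dd 1 g x| ≤ |v 0| * |Dd 0 g x| + |v 1| * |Dd 1 g x| := by
          rw [← abs_mul, ← abs_mul]; exact abs_add_le _ _
      _ ≤ ‖v‖ * |Dd 0 g x| + ‖v‖ * |Dd 1 g x| := by gcongr <;> exact hi _
      _ = _ := by ring
  rw [h1]
  have hI : 0 ≤ ∫ x in BB, (|Dd 0 g x| + |Dd 1 g x|) := integral_nonneg fun x => by positivity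
  set I := ∫ x in BB, (|Dd 0 g x| + |Dd 1 g x|)
  have h3 : ∫⁻ x, ‖g x‖ₑ ^ (2:ℝ) ≤ ENNReal.ofReal (K * I ^ 2) := by
    refine hS.trans ?_
    rw [ENNReal.ofReal_mul (by positivity), ENNReal.ofReal_coe_nnreal]
    gcongr
    calc (∫⁻ x, ‖fderiv ℝ g x‖ₑ) ^ (2:ℝ) ≤ (ENNReal.ofReal I) ^ (2:ℝ) := by gcongr
      _ = ENNReal.ofReal (I ^ 2) := by
        rw [ENNReal.ofReal_pow hI]; norm_num
  refine (ENNReal.toReal_mono ENNReal.ofReal_ne_top h3).trans ?_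
  rw [ENNReal.toReal_ofReal (by positivity)]
  gcongr
  linarith


/-! ### The regularized setting -/

/-- The regularized setting: all functions are global, the equation holds in a compact part. -/
structure Setup (β a b ε : ℝ) (c : E2) (V U W : E2 → ℝ) : Prop where
  hε : 0 < ε
  hε' : ε ≤ 1 / 100
  hc : sq2 c = 1 / 4
  hV : LipschitzWith (Real.toNNReal ((β + 1) * a / 2)) V
  hVa : ∀ x, 1 / 4 + ε ≤ sq2 x → sq2 x ≤ 1 - ε → a ≤ V x ∧ V x ≤ b
  hU : ContDiff ℝ 2 U
  hU0 : ∀ x, 0 ≤ U x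
  hW : ContDiff ℝ 1 W
  hW0 : ∀ x, 0 ≤ W x
  hWe : ∀ x, 1 / 4 + ε ≤ sq2 x → sq2 x ≤ 1 - ε → W x = ‖x - c‖ ^ (2 * β)
  hWd : ∀ x, 1 / 4 + ε ≤ sq2 x → sq2 x ≤ 1 - ε →
    (x 0 - c 0) * Dd 0 W x + (x 1 - c 1) * Dd 1 W x = 2 * β * W x
  heq : ∀ x, 1 / 4 + ε ≤ sq2 x → sq2 x ≤ 1 - ε →
    Dd 0 (Dd 0 U) x + Dd 1 (Dd 1 U) x = - (W x * V x * Real.exp (U x))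
  hT : ∀ x, 1 / 4 + ε ≤ sq2 x → sq2 x ≤ 1 - ε → (sq2 x ≤ 1 / 4 + 2 * ε ∨ 1 - 2 * ε ≤ sq2 x) →
    |x 0 * Dd 1 U x - x 1 * Dd 0 U x| *
      (|x 0 * Dd 1 U x - x 1 * Dd 0 U x| + |Dd 0 U x| + |Dd 1 U x|) ≤ 1

lemma norm_y_bounds {c x : E2} (hc : sq2 c = 1 / 4) (h1 : 4 / 10 ≤ sq2 x) (h2 : sq2 x ≤ 1) :
    1 / 10 ≤ ‖x - c‖ ∧ ‖x - c‖ ≤ 3 / 2 := by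
  have hcn : ‖c‖ = 1 / 2 := by
    have := sq2_eq c
    rw [hc] at this
    nlinarith [norm_nonneg c]
  have hx := sq2_eq x
  have a1 := norm_sub_norm_le x c
  have a2 := norm_sub_le x c
  have hxn := norm_nonneg x
  have h3 : 6 / 10 ≤ ‖x‖ := by nlinarith
  have h4 : ‖x‖ ≤ 1 := by nlinarith
  constructor <;> linarith

lemma weight_bounds (β : ℝ) : ∃ w1 > (0:ℝ), ∃ w2 > (0:ℝ), ∀ c x : E2, sq2 c = 1 / 4 →
    4 / 10 ≤ sq2 x → sq2 x ≤ 1 → w1 ≤ ‖x - c‖ ^ (2 * β) ∧ ‖x - c‖ ^ (2 * β) ≤ w2 := by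
  have hcont : ContinuousOn (fun t : ℝ => t ^ (2 * β)) (Set.Icc (1 / 10) (3 / 2)) := by
    apply ContinuousOn.rpow_const continuousOn_id
    intro t ht; left; have := ht.1; simp only [id]; intro h; rw [h] at this; norm_num at this
  have hne : (Set.Icc (1 / 10 : ℝ) (3 / 2)).Nonempty := ⟨1, by norm_num, by norm_num⟩
  obtain ⟨t1, ht1, hm⟩ := isCompact_Icc.exists_isMinOn hne hcont
  obtain ⟨t2, ht2, hM⟩ := isCompact_Icc.exists_isMaxOn hne hcont
  have p1 : 0 < t1 := by have := ht1.1; linarith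
  have p2 : 0 < t2 := by have := ht2.1; linarith
  refine ⟨t1 ^ (2 * β), by positivity, t2 ^ (2 * β), by positivity, ?_⟩
  intro c x hc h1 h2
  have hy := norm_y_bounds hc h1 h2
  exact ⟨hm ⟨hy.1, hy.2⟩, hM ⟨hy.1, hy.2⟩⟩

/-- smooth transition -/
lemma st_cd {n : ℕ∞} : ContDiff ℝ n Real.smoothTransition := Real.smoothTransition.contDiff

/-- profile of the first cutoff -/
def gxi (t : ℝ) : ℝ :=
  Real.smoothTransition ((t - 4 / 10) * 20) * Real.smoothTransition ((9 / 10 - t) * 20)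

/-- first cutoff -/
def xi (x : E2) : ℝ := gxi (sq2 x)

lemma gxi_cd : ContDiff ℝ 2 gxi := by
  unfold gxi
  have h : ContDiff ℝ 2 Real.smoothTransition := st_cd (n := 2)
  exact (h.comp (by fun_prop)).mul (h.comp (by fun_prop))

lemma xi_cd : ContDiff ℝ 2 xi := gxi_cd.comp contDiff_sq2

lemma xi_nonneg (x : E2) : 0 ≤ xi x :=
  mul_nonneg (Real.smoothTransition.nonneg _) (Real.smoothTransition.nonneg _)

lemma xi_zero {x : E2} (h : sq2 x ≤ 4 / 10 ∨ 9 / 10 ≤ sq2 x) : xi x = 0 := by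
  unfold xi gxi
  rcases h with h | h
  · rw [Real.smoothTransition.zero_of_nonpos (by linarith), zero_mul]
  · rw [Real.smoothTransition.zero_of_nonpos (x := (9 / 10 - sq2 x) * 20) (by linarith), mul_zero]

lemma xi_one {x : E2} (h1 : 5 / 10 ≤ sq2 x) (h2 : sq2 x ≤ 8 / 10) : xi x = 1 := by
  unfold xi gxi
  rw [Real.smoothTransition.one_of_one_le (by linarith),
    Real.smoothTransition.one_of_one_le (by linarith), one_mul]

lemma bdd_on_BB {m : E2 → ℝ} (hm : Continuous m) : ∃ C > (0:ℝ), ∀ x ∈ BB, |m x| ≤ C := by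
  obtain ⟨C, hC⟩ := isCompact_BB.exists_bound_of_continuousOn hm.continuousOn
  exact ⟨max C 1, by positivity, fun x hx => (hC x hx).trans (le_max_left _ _)⟩

lemma int_mono_BB {f g : E2 → ℝ} (hf : Continuous f) (hg : Continuous g)
    (h : ∀ x ∈ BB, f x ≤ g x) : ∫ x in BB, f x ≤ ∫ x in BB, g x :=
  setIntegral_mono_on (intBB hf) (intBB hg) measurableSet_BB h

lemma lap_xi4 : ∃ m : E2 → ℝ, Continuous m ∧ ContDiff ℝ 2 (fun x => xi x ^ 4) ∧ ∀ x,
    Dd 0 (Dd 0 (fun x => xi x ^ 4)) x + Dd 1 (Dd 1 (fun x => xi x ^ 4)) x = xi x ^ 2 * m x := by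
  have h1 : ContDiff ℝ 1 xi := xi_cd.of_le (by norm_num)
  have hD := fun i => contDiff_Dd xi_cd i
  refine ⟨fun x => 12 * (Dd 0 xi x ^ 2 + Dd 1 xi x ^ 2) +
    4 * xi x * (Dd 0 (Dd 0 xi) x + Dd 1 (Dd 1 xi) x), ?_, xi_cd.pow 4, ?_⟩
  · have c1 := fun i => (hD i).continuous
    have c2 := fun i => continuous_Dd (hD i) i
    have c3 := h1.continuous
    have := c1 0; have := c1 1; have := c2 0; have := c2 1
    fun_prop
  · intro x
    have e : ∀ i, Dd i (fun x => xi x ^ 4) = fun x => (4 * (xi x ^ 2 * xi x)) * Dd i xi x := by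
      intro i; ext x
      have : (fun x => xi x ^ 4) = fun x => (xi x ^ 2) ^ 2 := by ext; ring
      rw [this, Dd_sq (cd_diff (h1.pow 2) x), Dd_sq (cd_diff h1 x)]; ring
    have e2 : ∀ i, Dd i (Dd i (fun x => xi x ^ 4)) x = 12 * xi x ^ 2 * Dd i xi x ^ 2 +
        4 * xi x ^ 3 * Dd i (Dd i xi) x := by
      intro i
      rw [e, Dd_mul (cd_diff (contDiff_const.mul ((h1.pow 2).mul h1)) x) (cd_diff (hD i) x),
        Dd_mul (cd_diff contDiff_const x) (cd_diff ((h1.pow 2).mul h1) x), Dd_const,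
        Dd_mul (cd_diff (h1.pow 2) x) (cd_diff h1 x), Dd_sq (cd_diff h1 x)]
      ring
    rw [e2, e2]; ring

/-- Step 1: interior `L¹` bound for `exp U`. -/
lemma step1 (β a b : ℝ) (ha : 0 < a) : ∃ C > (0:ℝ), ∀ ε c V U W, Setup β a b ε c V U W →
    ∫ x in BB, xi x ^ 4 * Real.exp (U x) ≤ C := by
  obtain ⟨w1, hw1, w2, hw2, hw⟩ := weight_bounds β
  obtain ⟨m, hmc, h4, hm⟩ := lap_xi4
  obtain ⟨C2, hC2, hb⟩ := bdd_on_BB hmc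
  set c0 := w1 * a with hc0
  have hc0p : 0 < c0 := by positivity
  refine ⟨4 * C2 ^ 2 / c0 ^ 2 * (volume.real BB) + 1, by positivity, ?_⟩
  intro ε c V U W S
  have hUc := S.hU.continuous
  have hxc := xi_cd.continuous
  have hVc := S.hV.continuous
  have hWc := S.hW.continuous
  have hz : ∀ x, 1 < sq2 x → xi x ^ 4 = 0 := fun x hx => by
    rw [xi_zero (Or.inr (by linarith))]; norm_num
  have G := ident_green h4 S.hU hz
  have e1 : ∫ x in BB, xi x ^ 4 * (Dd 0 (Dd 0 U) x + Dd 1 (Dd 1 U) x) =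
      - ∫ x in BB, xi x ^ 4 * (W x * V x * Real.exp (U x)) := by
    rw [← integral_neg]
    congr 1; ext x
    by_cases hx : sq2 x ≤ 4 / 10 ∨ 9 / 10 ≤ sq2 x
    · rw [xi_zero hx]; norm_num
    · push Not at hx
      have := S.hε'
      rw [S.heq x (by linarith) (by linarith)]; ring
  simp only [hm] at G
  rw [e1] at G
  have i1 : ∫ x in BB, c0 * (xi x ^ 4 * Real.exp (U x)) ≤
      ∫ x in BB, xi x ^ 4 * (W x * V x * Real.exp (U x)) := by
    apply int_mono_BB (by fun_prop) (by fun_prop)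
    intro x _
    by_cases hx : sq2 x ≤ 4 / 10 ∨ 9 / 10 ≤ sq2 x
    · rw [xi_zero hx]; norm_num
    · push Not at hx
      have := S.hε'
      have hWx := (hw c x S.hc (by linarith) (by linarith)).1
      rw [← S.hWe x (by linarith) (by linarith)] at hWx
      have hVx := (S.hVa x (by linarith) (by linarith)).1
      have : c0 ≤ W x * V x := mul_le_mul hWx hVx ha.le (S.hW0 x)
      have hp : 0 ≤ xi x ^ 4 * Real.exp (U x) := by positivity
      nlinarith
  have i2 : - ∫ x in BB, U x * (xi x ^ 2 * m x) ≤
      ∫ x in BB, (c0 / 2 * (xi x ^ 4 * Real.exp (U x)) + 2 * C2 ^ 2 / c0) := by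
    rw [← integral_neg]
    apply int_mono_BB (by fun_prop) (by fun_prop)
    intro x hx
    have hbx := abs_le.1 (hb x hx)
    have hu := S.hU0 x
    have he : U x / 2 ≤ Real.exp (U x / 2) := by linarith [Real.add_one_le_exp (U x / 2)]
    have hee : Real.exp (U x) = Real.exp (U x / 2) ^ 2 := by
      rw [← Real.exp_nat_mul]; congr 1; push_cast; ring
    rw [hee]
    set E := Real.exp (U x / 2)
    have hx2 : 0 ≤ xi x ^ 2 := by positivity
    have s1 : -(U x * (xi x ^ 2 * m x)) ≤ 2 * C2 * (xi x ^ 2 * E) := by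
      have : U x * xi x ^ 2 * (-m x) ≤ U x * xi x ^ 2 * C2 := by
        apply mul_le_mul_of_nonneg_left (by linarith) (by positivity)
      have : U x * (xi x ^ 2 * C2) ≤ 2 * E * (xi x ^ 2 * C2) :=
        mul_le_mul_of_nonneg_right (by linarith) (by positivity)
      linarith
    refine s1.trans ?_
    have : 0 ≤ (c0 * (xi x ^ 2 * E) - 2 * C2) ^ 2 / (2 * c0) := by positivity
    have e : (c0 * (xi x ^ 2 * E) - 2 * C2) ^ 2 / (2 * c0) =
        c0 / 2 * (xi x ^ 4 * E ^ 2) + 2 * C2 ^ 2 / c0 - 2 * C2 * (xi x ^ 2 * E) := by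
      field_simp; ring
    linarith
  rw [integral_add (intBB (by fun_prop)) (intBB (by fun_prop)), integral_const_mul] at i2
  rw [integral_const_mul] at i1
  simp only [integral_const, smul_eq_mul, measureReal_restrict_apply_univ] at i2
  set I := ∫ x in BB, xi x ^ 4 * Real.exp (U x)
  have : c0 / 2 * I ≤ volume.real BB * (2 * C2 ^ 2 / c0) := by linarith
  have h5 : I ≤ 4 * C2 ^ 2 / c0 ^ 2 * (volume.real BB) := by
    have : I = (c0 / 2 * I) * (2 / c0) := by field_simp
    rw [this]
    calc (c0 / 2 * I) * (2 / c0) ≤ (volume.real BB * (2 * C2 ^ 2 / c0)) * (2 / c0) := by gcongr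
      _ = _ := by field_simp; ring
  linarith


/-! ### A good annulus -/

lemma cs_ineq {μ : Measure E2} {f g : E2 → ℝ} (hf : Integrable (fun x => f x ^ 2) μ)
    (hg : Integrable (fun x => g x ^ 2) μ) (hfg : Integrable (fun x => f x * g x) μ) :
    (∫ x, f x * g x ∂μ) ^ 2 ≤ (∫ x, f x ^ 2 ∂μ) * ∫ x, g x ^ 2 ∂μ := by
  have h : ∀ t : ℝ, 0 ≤ (∫ x, f x ^ 2 ∂μ) * (t * t) + (2 * ∫ x, f x * g x ∂μ) * t +
      ∫ x, g x ^ 2 ∂μ := by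
    intro t
    have : 0 ≤ ∫ x, (t * f x + g x) ^ 2 ∂μ := integral_nonneg fun x => sq_nonneg _
    have e : (fun x => (t * f x + g x) ^ 2) =
        fun x => (t * t) * f x ^ 2 + (2 * t) * (f x * g x) + g x ^ 2 := by ext x; ring
    have h3 : Integrable (fun x => (t * t) * f x ^ 2 + (2 * t) * (f x * g x)) μ :=
      (hf.const_mul _).add (hfg.const_mul _)
    rw [e, integral_add h3 hg,
      integral_add (hf.const_mul _) (hfg.const_mul _), integral_const_mul, integral_const_mul] at this
    linarith
  have := discrim_le_zero h
  unfold discrim at this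
  nlinarith

/-- bump profile on [0,1] -/
def geta (t : ℝ) : ℝ := Real.smoothTransition (4 * t) * Real.smoothTransition (4 * (1 - t))

lemma geta_cd : ContDiff ℝ 2 geta := by
  unfold geta
  have h : ContDiff ℝ 2 Real.smoothTransition := st_cd (n := 2)
  exact (h.comp (by fun_prop)).mul (h.comp (by fun_prop))

lemma geta_nonneg (t : ℝ) : 0 ≤ geta t :=
  mul_nonneg (Real.smoothTransition.nonneg _) (Real.smoothTransition.nonneg _)

lemma geta_le_one (t : ℝ) : geta t ≤ 1 :=
  mul_le_one₀ (Real.smoothTransition.le_one _) (Real.smoothTransition.nonneg _)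
    (Real.smoothTransition.le_one _)

lemma geta_zero {t : ℝ} (h : t ≤ 0 ∨ 1 ≤ t) : geta t = 0 := by
  unfold geta
  rcases h with h | h
  · rw [Real.smoothTransition.zero_of_nonpos (by linarith), zero_mul]
  · rw [Real.smoothTransition.zero_of_nonpos (x := 4 * (1 - t)) (by linarith), mul_zero]

lemma geta_one {t : ℝ} (h1 : 1 / 4 ≤ t) (h2 : t ≤ 3 / 4) : geta t = 1 := by
  unfold geta
  rw [Real.smoothTransition.one_of_one_le (by linarith),
    Real.smoothTransition.one_of_one_le (by linarith), one_mul]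

lemma deriv_zero_of_nonneg {g : ℝ → ℝ} (h : ∀ t, 0 ≤ g t) {t : ℝ} (ht : g t = 0) :
    deriv g t = 0 := by
  apply IsLocalMin.deriv_eq_zero
  exact Filter.Eventually.of_forall fun s => by rw [ht]; exact h s

/-- radial bump in the annulus `p < |x|² < p + w` -/
def eta (p w : ℝ) (x : E2) : ℝ := geta ((sq2 x - p) / w)

lemma getaw_cd (p w : ℝ) : ContDiff ℝ 2 (fun t => geta ((t - p) / w)) :=
  geta_cd.comp (by fun_prop)

lemma eta_cd (p w : ℝ) : ContDiff ℝ 2 (eta p w) := (getaw_cd p w).comp contDiff_sq2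

/-- the open-closed shell -/
def shell (p w : ℝ) : Set E2 := {x | p < sq2 x ∧ sq2 x ≤ p + w}

lemma measurableSet_shell (p w : ℝ) : MeasurableSet (shell p w) := by
  have h : Measurable sq2 := continuous_sq2.measurable
  exact (measurableSet_lt measurable_const h).inter (measurableSet_le h measurable_const)

lemma eta_zero {p w : ℝ} (hw : 0 < w) {x : E2} (hx : x ∉ shell p w) : eta p w x = 0 := by
  apply geta_zero
  by_cases h : p < sq2 x
  · right
    have : ¬ (sq2 x ≤ p + w) := fun h' => hx ⟨h, h'⟩
    rw [le_div_iff₀ hw]; linarith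
  · left
    exact div_nonpos_of_nonpos_of_nonneg (by linarith) hw.le

lemma Dd_eta_zero {p w : ℝ} (hw : 0 < w) {x : E2} (hx : x ∉ shell p w) (i : Fin 2) :
    Dd i (eta p w) x = 0 := by
  have : eta p w = fun y => (fun t => geta ((t - p) / w)) (sq2 y) := rfl
  rw [this, Dd_radial ((getaw_cd p w).differentiable (by norm_num))]
  rw [deriv_zero_of_nonneg (fun t => geta_nonneg _)]
  · ring
  · exact eta_zero hw hx

lemma coord_le {x : E2} (hx : sq2 x ≤ 1) (i : Fin 2) : |x i| ≤ 1 := by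
  have h : x i ^ 2 ≤ 1 := by
    unfold sq2 at hx
    fin_cases i
    · show x 0 ^ 2 ≤ 1
      nlinarith [sq_nonneg (x 1)]
    · show x 1 ^ 2 ≤ 1
      nlinarith [sq_nonneg (x 0)]
  exact (sq_le_one_iff_abs_le_one _).1 h

lemma geta_deriv_bdd : ∃ G > (0:ℝ), ∀ t, |deriv geta t| ≤ G := by
  have hc : Continuous (deriv geta) := geta_cd.continuous_deriv (by norm_num)
  obtain ⟨C, hC⟩ := (isCompact_Icc (a := (0:ℝ)) (b := 1)).exists_bound_of_continuousOn
    hc.continuousOn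
  refine ⟨max C 1, by positivity, fun t => ?_⟩
  by_cases ht : t ∈ Set.Icc (0:ℝ) 1
  · exact (hC t ht).trans (le_max_left _ _)
  · rw [deriv_zero_of_nonneg geta_nonneg]
    · simp
    · apply geta_zero
      by_contra h
      push Not at h
      exact ht ⟨h.1.le, h.2.le⟩

lemma deriv_resc {g : ℝ → ℝ} (hg : Differentiable ℝ g) (p w t : ℝ) :
    deriv (fun t => g ((t - p) / w)) t = deriv g ((t - p) / w) / w := by
  have h1 : HasDerivAt (fun t : ℝ => (t - p) / w) (1 / w) t :=
    ((hasDerivAt_id t).sub_const p).div_const w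
  have := (hg _).hasDerivAt.comp t h1
  rw [← div_eq_mul_one_div] at this
  exact this.deriv

lemma Dd_eta_bdd {w : ℝ} (hw : 0 < w) : ∃ G > (0:ℝ), ∀ p x i, sq2 x ≤ 1 →
    |Dd i (eta p w) x| ≤ G := by
  obtain ⟨G, hG, hb⟩ := geta_deriv_bdd
  refine ⟨2 * (G / w), by positivity, fun p x i hx => ?_⟩
  have : eta p w = fun y => (fun t => geta ((t - p) / w)) (sq2 y) := rfl
  rw [this, Dd_radial ((getaw_cd p w).differentiable (by norm_num)),
    deriv_resc (geta_cd.differentiable (by norm_num)), abs_mul, abs_mul, abs_div, abs_of_pos hw]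
  have h1 := hb ((sq2 x - p) / w)
  have h2 := coord_le hx i
  calc |2| * (|deriv geta ((sq2 x - p) / w)| / w) * |x i| ≤ 2 * (G / w) * 1 := by
        gcongr; norm_num
    _ = _ := by ring

lemma int_shell {p w : ℝ} (h : p + w ≤ 1) {f : E2 → ℝ} (hf : ∀ x, x ∉ shell p w → f x = 0) :
    ∫ x in BB, f x = ∫ x in shell p w, f x := by
  apply setIntegral_eq_of_subset_of_forall_sdiff_eq_zero measurableSet_BB
  · intro x hx; exact le_trans hx.2 h
  · intro x hx; exact hf x hx.2

lemma intShell {p w : ℝ} (h : p + w ≤ 1) {f : E2 → ℝ} (hf : Continuous f) :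
    IntegrableOn f (shell p w) :=
  (intBB hf).mono_set fun _ hx => le_trans hx.2 h

lemma eps_reg {β a b ε : ℝ} {c : E2} {V U W : E2 → ℝ} (S : Setup β a b ε c V U W)
    {p w G K Cf ε0 : ℝ} (hw : 0 < w) (hp : 5 / 10 ≤ p) (hpw : p + w ≤ 8 / 10) (hG0 : 0 < G)
    (hG : ∀ x i, sq2 x ≤ 1 → |Dd i (eta p w) x| ≤ G) (hK0 : 0 < K)
    (hK : ∀ g : E2 → ℝ, ContDiff ℝ 1 g → (∀ x, 1 < sq2 x → g x = 0) →
      ∫ x in BB, g x ^ 2 ≤ K * (∫ x in BB, (|Dd 0 g x| + |Dd 1 g x|)) ^ 2)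
    (hCf0 : 0 < Cf) (hCf : ∀ x, 4 / 10 ≤ sq2 x → sq2 x ≤ 9 / 10 → W x * V x ≤ Cf)
    (hε0 : 0 < ε0) (hε1 : 4 * Cf * K * ε0 ≤ 1 / 4)
    (hJ : ∫ x in shell p w, Real.exp (U x) ≤ ε0) :
    ∫ x in BB, eta p w x ^ 2 * Real.exp (U x) * (Dd 0 U x ^ 2 + Dd 1 U x ^ 2) ≤
      4 * (4 * G ^ 2 * ε0 + 8 * Cf * K * G ^ 2 * ε0 ^ 2) := by
  have hpw1 : p + w ≤ 1 := by linarith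
  have hU1 : ContDiff ℝ 1 U := S.hU.of_le (by norm_num)
  have hη1 : ContDiff ℝ 1 (eta p w) := (eta_cd p w).of_le (by norm_num)
  have cU := hU1.continuous
  have cη := hη1.continuous
  have cU0 := continuous_Dd hU1 0
  have cU1 := continuous_Dd hU1 1
  have cη0 := continuous_Dd hη1 0
  have cη1 := continuous_Dd hη1 1
  have cU00 := continuous_Dd (contDiff_Dd S.hU 0) 0
  have cU11 := continuous_Dd (contDiff_Dd S.hU 1) 1
  have hout : ∀ x, 1 < sq2 x → x ∉ shell p w := fun x hx h => by have := h.2; linarith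
  have hη0 : ∀ x, 1 < sq2 x → eta p w x = 0 := fun x hx => eta_zero hw (hout x hx)
  set J := ∫ x in shell p w, Real.exp (U x) with hJdef
  have hJ0 : 0 ≤ J := integral_nonneg fun x => (Real.exp_pos _).le
  set E := ∫ x in BB, eta p w x ^ 2 * Real.exp (U x) * (Dd 0 U x ^ 2 + Dd 1 U x ^ 2) with hE
  -- Sobolev
  have hS := hK (fun x => eta p w x * Real.exp (U x)) (hη1.mul hU1.exp)
    (fun x hx => by simp [hη0 x hx])
  set Y := ∫ x in shell p w,
    Real.exp (U x / 2) * (Real.exp (U x / 2) * (eta p w x * (|Dd 0 U x| + |Dd 1 U x|))) with hY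
  have hee : ∀ x, Real.exp (U x) = Real.exp (U x / 2) ^ 2 := fun x => by
    rw [← Real.exp_nat_mul]; congr 1; push_cast; ring
  have hY0 : 0 ≤ Y := integral_nonneg fun x => by
    have : 0 ≤ eta p w x := geta_nonneg _
    positivity
  have hYsq : Y ^ 2 ≤ J * (2 * E) := by
    have h1 := cs_ineq (μ := volume.restrict (shell p w)) (f := fun x => Real.exp (U x / 2))
      (g := fun x => Real.exp (U x / 2) * (eta p w x * (|Dd 0 U x| + |Dd 1 U x|)))
      (intShell hpw1 (by fun_prop)) (intShell hpw1 (by fun_prop)) (intShell hpw1 (by fun_prop))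
    refine h1.trans ?_
    have e1 : ∫ x in shell p w, Real.exp (U x / 2) ^ 2 = J := by
      rw [hJdef]; congr 1; ext x; rw [hee]
    rw [e1]
    apply mul_le_mul_of_nonneg_left _ hJ0
    rw [hE, int_shell hpw1 (fun x hx => by rw [eta_zero hw hx]; ring), ← integral_const_mul]
    apply setIntegral_mono_on (intShell hpw1 (by fun_prop)) (intShell hpw1 (by fun_prop))
      (measurableSet_shell p w)
    intro x _
    rw [hee x]
    have : (|Dd 0 U x| + |Dd 1 U x|) ^ 2 ≤ 2 * (Dd 0 U x ^ 2 + Dd 1 U x ^ 2) := by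
      rw [← sq_abs (Dd 0 U x), ← sq_abs (Dd 1 U x)]
      nlinarith [sq_nonneg (|Dd 0 U x| - |Dd 1 U x|)]
    calc (Real.exp (U x / 2) * (eta p w x * (|Dd 0 U x| + |Dd 1 U x|))) ^ 2
        = (Real.exp (U x / 2) ^ 2 * eta p w x ^ 2) * (|Dd 0 U x| + |Dd 1 U x|) ^ 2 := by ring
      _ ≤ (Real.exp (U x / 2) ^ 2 * eta p w x ^ 2) * (2 * (Dd 0 U x ^ 2 + Dd 1 U x ^ 2)) := by
          gcongr
      _ = _ := by ring
  have hT : ∫ x in BB, (|Dd 0 (fun x => eta p w x * Real.exp (U x)) x| +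
      |Dd 1 (fun x => eta p w x * Real.exp (U x)) x|) ≤ 2 * G * J + Y := by
    have e : ∀ i x, Dd i (fun x => eta p w x * Real.exp (U x)) x =
        eta p w x * (Real.exp (U x) * Dd i U x) + Dd i (eta p w) x * Real.exp (U x) := by
      intro i x
      rw [Dd_mul (cd_diff hη1 x) (cd_diff hU1.exp x), Dd_exp (cd_diff hU1 x)]
    simp only [e]
    rw [int_shell hpw1 (fun x hx => by
      rw [eta_zero hw hx, Dd_eta_zero hw hx, Dd_eta_zero hw hx]; norm_num), hJdef, hY,
      ← integral_const_mul, ← integral_add (intShell hpw1 (by fun_prop))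
        (intShell hpw1 (by fun_prop))]
    apply setIntegral_mono_on (intShell hpw1 (by fun_prop)) (intShell hpw1 (by fun_prop))
      (measurableSet_shell p w)
    intro x hx
    have hxx : sq2 x ≤ 1 := le_trans hx.2 hpw1
    have hη : 0 ≤ eta p w x := geta_nonneg _
    have b : ∀ i, |eta p w x * (Real.exp (U x) * Dd i U x) + Dd i (eta p w) x * Real.exp (U x)| ≤
        eta p w x * (Real.exp (U x) * |Dd i U x|) + G * Real.exp (U x) := by
      intro i
      refine (abs_add_le _ _).trans ?_
      rw [abs_mul, abs_mul, abs_mul, abs_of_nonneg hη, abs_of_pos (Real.exp_pos _)]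
      gcongr
      exact hG x i hxx
    have e2 : Real.exp (U x / 2) *
        (Real.exp (U x / 2) * (eta p w x * (|Dd 0 U x| + |Dd 1 U x|))) =
        Real.exp (U x) * (eta p w x * (|Dd 0 U x| + |Dd 1 U x|)) := by
      rw [hee x]; ring
    rw [e2]
    linarith [b 0, b 1]
  have hg2 : ∫ x in BB, (eta p w x * Real.exp (U x)) ^ 2 ≤ K * (8 * G ^ 2 * J ^ 2 + 4 * J * E) := by
    refine hS.trans ?_
    apply mul_le_mul_of_nonneg_left _ hK0.le
    have h0 : 0 ≤ ∫ x in BB, (|Dd 0 (fun x => eta p w x * Real.exp (U x)) x| +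
      |Dd 1 (fun x => eta p w x * Real.exp (U x)) x|) := integral_nonneg fun x => by positivity
    calc _ ≤ (2 * G * J + Y) ^ 2 := by gcongr
      _ ≤ 8 * G ^ 2 * J ^ 2 + 2 * Y ^ 2 := by nlinarith [sq_nonneg (2 * G * J - Y)]
      _ ≤ _ := by linarith
  -- the energy identity
  have hI := ident_exp hη1 S.hU hη0
  have hlow : ∫ x in BB, (1 / 2 * (eta p w x ^ 2 * Real.exp (U x) * (Dd 0 U x ^ 2 + Dd 1 U x ^ 2)) -
      2 * (Real.exp (U x) * (Dd 0 (eta p w) x ^ 2 + Dd 1 (eta p w) x ^ 2)) -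
      Cf * (eta p w x * Real.exp (U x)) ^ 2) ≤ 0 := by
    rw [← hI]
    apply int_mono_BB (by fun_prop) (by fun_prop)
    intro x _
    set X := Real.exp (U x) with hX
    have hXp : 0 < X := Real.exp_pos _
    have q1 : 0 ≤ X * ((1 / 2) * (eta p w x * Dd 0 U x + 2 * Dd 0 (eta p w) x) ^ 2 +
        (1 / 2) * (eta p w x * Dd 1 U x + 2 * Dd 1 (eta p w) x) ^ 2) := by positivity
    have q2 : - (Cf * (eta p w x * X) ^ 2) ≤
        eta p w x ^ 2 * X * (Dd 0 (Dd 0 U) x + Dd 1 (Dd 1 U) x) := by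
      by_cases hx : x ∈ shell p w
      · have h1 := hx.1
        have h2 := hx.2
        have := S.hε'
        rw [S.heq x (by linarith) (by linarith)]
        have := hCf x (by linarith) (by linarith)
        have h3 : (eta p w x * X) ^ 2 * (W x * V x) ≤ (eta p w x * X) ^ 2 * Cf := by gcongr
        rw [← hX]
        linarith
      · rw [eta_zero hw hx]; norm_num
    linarith
  have hη2 : ∫ x in BB, Real.exp (U x) * (Dd 0 (eta p w) x ^ 2 + Dd 1 (eta p w) x ^ 2) ≤
      2 * G ^ 2 * J := by
    rw [int_shell hpw1 (fun x hx => by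
      rw [Dd_eta_zero hw hx, Dd_eta_zero hw hx]; norm_num), hJdef, ← integral_const_mul]
    apply setIntegral_mono_on (intShell hpw1 (by fun_prop)) (intShell hpw1 (by fun_prop))
      (measurableSet_shell p w)
    intro x hx
    have hxx : sq2 x ≤ 1 := le_trans hx.2 hpw1
    have b : ∀ i, Dd i (eta p w) x ^ 2 ≤ G ^ 2 := fun i =>
      sq_le_sq' (by linarith [abs_le.1 (hG x i hxx)]) (abs_le.1 (hG x i hxx)).2
    have := b 0; have := b 1
    have hXp : 0 < Real.exp (U x) := Real.exp_pos _
    calc _ ≤ Real.exp (U x) * (G ^ 2 + G ^ 2) := by gcongr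
      _ = _ := by ring
  rw [integral_sub ((intBB (by fun_prop))) (intBB (by fun_prop)),
    integral_sub (intBB (by fun_prop)) (intBB (by fun_prop)), integral_const_mul,
    integral_const_mul, integral_const_mul, ← hE] at hlow
  have hE0 : 0 ≤ E := integral_nonneg fun x => by positivity
  have f1 : Cf * ∫ x in BB, (eta p w x * Real.exp (U x)) ^ 2 ≤
      Cf * (K * (8 * G ^ 2 * J ^ 2 + 4 * J * E)) := by gcongr
  have f2 : Cf * (K * (8 * G ^ 2 * J ^ 2 + 4 * J * E)) ≤
      Cf * (K * (8 * G ^ 2 * ε0 ^ 2 + 4 * ε0 * E)) := by gcongr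
  have f3 : 2 * G ^ 2 * J ≤ 2 * G ^ 2 * ε0 := by gcongr
  have f4 : (4 * Cf * K * ε0) * E ≤ 1 / 4 * E := by gcongr
  linarith

/-- Steps 2 and 3: existence of a good annulus. -/
lemma step3 (β a b : ℝ) (ha : 0 < a) (hab : a ≤ b) : ∃ w > (0:ℝ), ∃ C > (0:ℝ),
    ∀ ε c V U W, Setup β a b ε c V U W → ∃ p, 5 / 10 ≤ p ∧ p + w ≤ 8 / 10 ∧
    ∫ x in BB, eta p w x ^ 2 * Real.exp (U x) ≤ C ∧
    ∫ x in BB, eta p w x ^ 2 * Real.exp (U x) * (Dd 0 U x ^ 2 + Dd 1 U x ^ 2) ≤ C := by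
  obtain ⟨C1, hC1, h1⟩ := step1 β a b ha
  obtain ⟨K, hK0, hK⟩ := sobolev_const
  obtain ⟨w1, hw1, w2, hw2, hwb⟩ := weight_bounds β
  have hb : 0 < b := ha.trans_le hab
  set Cf := w2 * b with hCf
  have hCf0 : 0 < Cf := by positivity
  set ε0 := 1 / (16 * Cf * K) with hε0
  have hε0p : 0 < ε0 := by positivity
  obtain ⟨N, hN⟩ := exists_nat_gt (C1 / ε0)
  have hNp : (0:ℝ) < N := lt_trans (by positivity) hN
  have hN0 : 0 < N := by exact_mod_cast hNp
  set w := 3 / 10 / (N:ℝ) with hw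
  have hwp : 0 < w := by positivity
  have hNw : N * w = 3 / 10 := by rw [hw]; field_simp
  obtain ⟨G, hG0, hG⟩ := Dd_eta_bdd hwp
  refine ⟨w, hwp, 4 * (4 * G ^ 2 * ε0 + 8 * Cf * K * G ^ 2 * ε0 ^ 2) + ε0, by positivity, ?_⟩
  intro ε c V U W S
  have cU := S.hU.continuous
  have cξ := xi_cd.continuous
  have hsub : ∀ j ∈ Finset.range N, 5 / 10 + (j:ℝ) * w + w ≤ 8 / 10 := by
    intro j hj
    have : (j:ℝ) + 1 ≤ N := by exact_mod_cast Finset.mem_range.1 hj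
    have : ((j:ℝ) + 1) * w ≤ N * w := by gcongr
    linarith
  have hsum : ∑ j ∈ Finset.range N, ∫ x in shell (5 / 10 + j * w) w, Real.exp (U x) ≤
      ∑ _j ∈ Finset.range N, C1 / N := by
    have e : ∑ _j ∈ Finset.range N, C1 / (N:ℝ) = C1 := by
      rw [Finset.sum_const, Finset.card_range, nsmul_eq_mul]; field_simp
    rw [e]
    refine le_trans ?_ (h1 ε c V U W S)
    rw [← integral_biUnion_finset (Finset.range N) (fun j _ => measurableSet_shell _ _)]
    · calc ∫ x in ⋃ j ∈ Finset.range N, shell (5 / 10 + j * w) w, Real.exp (U x)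
          = ∫ x in ⋃ j ∈ Finset.range N, shell (5 / 10 + j * w) w,
              xi x ^ 4 * Real.exp (U x) := by
            apply setIntegral_congr_fun
            · exact Finset.measurableSet_biUnion _ fun j _ => measurableSet_shell _ _
            · intro x hx
              simp only [Set.mem_iUnion] at hx
              obtain ⟨j, hj, hx⟩ := hx
              have h3 := hsub j hj
              have : 0 ≤ (j:ℝ) * w := by positivity
              have h4 := hx.1
              have h5 := hx.2
              simp only
              rw [xi_one (by linarith) (by linarith)]; ring
        _ ≤ _ := by
            apply setIntegral_mono_set (intBB (by fun_prop))
            · exact Filter.Eventually.of_forall fun x => by positivity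
            · apply Filter.Eventually.of_forall
              intro x hx
              obtain ⟨t, ⟨j, rfl⟩, hx⟩ := hx
              simp only [Set.mem_iUnion] at hx
              obtain ⟨hj, hx⟩ := hx
              have h3 := hsub j hj
              have h5 := hx.2
              show sq2 x ≤ 1
              linarith
    · intro i hi j hj hij
      rw [Function.onFun, Set.disjoint_left]
      intro x hxi hxj
      rcases lt_or_gt_of_ne hij with h | h
      · have : (i:ℝ) + 1 ≤ j := by exact_mod_cast h
        have : ((i:ℝ) + 1) * w ≤ j * w := by gcongr
        linarith [hxi.2, hxj.1]
      · have : (j:ℝ) + 1 ≤ i := by exact_mod_cast h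
        have : ((j:ℝ) + 1) * w ≤ i * w := by gcongr
        linarith [hxj.2, hxi.1]
    · intro j hj
      exact intShell (by linarith [hsub j hj]) (by fun_prop)
  obtain ⟨j, hj, hjle⟩ := Finset.exists_le_of_sum_le (Finset.nonempty_range_iff.2 hN0.ne') hsum
  have hJ : ∫ x in shell (5 / 10 + j * w) w, Real.exp (U x) ≤ ε0 := by
    refine hjle.trans ?_
    rw [div_le_iff₀ hNp]
    rw [div_lt_iff₀ hε0p] at hN
    linarith
  have hp : (5:ℝ) / 10 ≤ 5 / 10 + j * w := by
    have : 0 ≤ (j:ℝ) * w := by positivity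
    linarith
  have h8 : 0 ≤ 4 * (4 * G ^ 2 * ε0 + 8 * Cf * K * G ^ 2 * ε0 ^ 2) := by positivity
  refine ⟨5 / 10 + j * w, hp, hsub j hj, ?_, ?_⟩
  · have cη := (eta_cd (5 / 10 + j * w) w).continuous
    have : ∫ x in BB, eta (5 / 10 + j * w) w x ^ 2 * Real.exp (U x) ≤
        ∫ x in shell (5 / 10 + j * w) w, Real.exp (U x) := by
      rw [int_shell (p := 5 / 10 + j * w) (w := w) (by linarith [hsub j hj])
        (fun x hx => by rw [eta_zero hwp hx]; ring)]
      apply setIntegral_mono_on (intShell (by linarith [hsub j hj]) (by fun_prop))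
        (intShell (by linarith [hsub j hj]) (by fun_prop)) (measurableSet_shell _ _)
      intro x _
      have h0 : 0 ≤ eta (5 / 10 + j * w) w x := geta_nonneg _
      have h1 : eta (5 / 10 + j * w) w x ≤ 1 := geta_le_one _
      have : eta (5 / 10 + j * w) w x ^ 2 ≤ 1 := pow_le_one₀ h0 h1
      have := Real.exp_pos (U x)
      nlinarith
    linarith
  · have := eps_reg S hwp hp (hsub j hj) hG0 (fun x i => hG _ x i) hK0 hK hCf0 ?_ hε0p ?_ hJ
    · linarith
    · intro x hx1 hx2
      have := S.hε'
      rw [S.hWe x (by linarith) (by linarith)]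
      have h3 := hwb c x S.hc hx1 (by linarith)
      have h4 := S.hVa x (by linarith) (by linarith)
      exact mul_le_mul h3.2 h4.2 (by linarith) hw2.le
    · rw [hε0]; apply le_of_eq; field_simp; norm_num


/-! ### Pohozaev inequality for radial cutoffs -/

/-- the quadratic form in the Pohozaev identity -/
def qf (c : E2) (U : E2 → ℝ) (x : E2) : ℝ :=
  ((x 0 - c 0) * Dd 0 U x + (x 1 - c 1) * Dd 1 U x) * (x 0 * Dd 0 U x + x 1 * Dd 1 U x) -
    1 / 2 * ((x 0 - c 0) * x 0 + (x 1 - c 1) * x 1) * (Dd 0 U x ^ 2 + Dd 1 U x ^ 2)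

/-- `y · x` -/
def yx (c x : E2) : ℝ := (x 0 - c 0) * x 0 + (x 1 - c 1) * x 1

/-- `x · ∇ U` -/
def rad (U : E2 → ℝ) (x : E2) : ℝ := x 0 * Dd 0 U x + x 1 * Dd 1 U x

lemma cont_coord (i : Fin 2) : Continuous (fun x : E2 => x i) := (contDiff_coord (n := 1) i).continuous

lemma continuous_qf {c : E2} {U : E2 → ℝ} (hU : ContDiff ℝ 2 U) : Continuous (qf c U) := by
  have h := fun i => (contDiff_Dd hU i).continuous
  have h0 := h 0
  have h1 := h 1
  have c0 := cont_coord 0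
  have c1 := cont_coord 1
  unfold qf
  fun_prop

lemma continuous_yx {c : E2} : Continuous (yx c) := by
  have c0 := cont_coord 0
  have c1 := cont_coord 1
  unfold yx
  fun_prop

lemma continuous_rad {U : E2 → ℝ} (hU : ContDiff ℝ 2 U) : Continuous (rad U) := by
  have h := fun i => (contDiff_Dd hU i).continuous
  have h0 := h 0
  have h1 := h 1
  have c0 := cont_coord 0
  have c1 := cont_coord 1
  unfold rad
  fun_prop

lemma y_sq_le {c x : E2} (hc : sq2 c = 1 / 4) (hx : sq2 x ≤ 1) :
    (x 0 - c 0) ^ 2 + (x 1 - c 1) ^ 2 ≤ (3 / 2) ^ 2 := by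
  unfold sq2 at *
  nlinarith [sq_nonneg (x 0 + 2 * c 0), sq_nonneg (x 1 + 2 * c 1)]

lemma poho_ineq {β a b ε : ℝ} (hβ : 0 < β + 1) (ha : 0 < a) {c : E2} {V U W : E2 → ℝ}
    (S : Setup β a b ε c V U W) {g : ℝ → ℝ} (hg : ContDiff ℝ 1 g)
    (hgn : ∀ t, 0 ≤ g t) (hg0 : ∀ t, t ≤ 1 / 4 + ε ∨ 1 - ε ≤ t → g t = 0) :
    |∫ x in BB, (2 * deriv g (sq2 x) * qf c U x + V x * W x * Real.exp (U x) *
      ((2 + 2 * β) * g (sq2 x) + 2 * deriv g (sq2 x) * yx c x))| ≤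
      3 / 4 * (β + 1) * a * ∫ x in BB, W x * Real.exp (U x) * g (sq2 x) := by
  have hεp := S.hε
  have hχ : ContDiff ℝ 1 (fun x : E2 => g (sq2 x)) := hg.comp contDiff_sq2
  have hχ0 : ∀ x : E2, 1 < sq2 x → g (sq2 x) = 0 := fun x hx => hg0 _ (Or.inr (by linarith))
  have hgd : Differentiable ℝ g := hg.differentiable (by norm_num)
  have hU1 : ContDiff ℝ 1 U := S.hU.of_le (by norm_num)
  have hE : ContDiff ℝ 1 (fun x => Real.exp (U x)) := hU1.exp
  have hB : ContDiff ℝ 1 (fun x => Real.exp (U x) * W x * g (sq2 x)) := (hE.mul S.hW).mul hχ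
  have cdg : Continuous (deriv g) := hg.continuous_deriv (by norm_num)
  have cs := continuous_sq2
  have cg := hg.continuous
  have cV : Continuous V := S.hV.continuous
  have cW := S.hW.continuous
  have cU := hU1.continuous
  have cq := continuous_qf (c := c) S.hU
  have cyx := continuous_yx (c := c)
  have d0 := (contDiff_Dd S.hU 0).continuous
  have d1 := (contDiff_Dd S.hU 1).continuous
  have c0 := cont_coord 0
  have c1 := cont_coord 1
  have h1 := ident_poho c hχ S.hU hχ0
  have h2 := ident_lip (V := V) (P := fun x => (Real.exp (U x) * W x * g (sq2 x)) * (x 0 - c 0))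
    (Q := fun x => (Real.exp (U x) * W x * g (sq2 x)) * (x 1 - c 1))
    (M := fun x => 3 / 2 * (W x * Real.exp (U x) * g (sq2 x))) S.hV
    (hB.mul (cd_y c 0)) (fun x hx => by simp [hχ0 x hx])
    (hB.mul (cd_y c 1)) (fun x hx => by simp [hχ0 x hx])
    (by fun_prop) (fun x _ => by
      have := S.hW0 x
      have := hgn (sq2 x)
      positivity) (fun x hx => by
      have := y_sq_le S.hc hx
      have h : 0 ≤ (Real.exp (U x) * W x * g (sq2 x)) ^ 2 := sq_nonneg _
      nlinarith)
  rw [Real.coe_toNNReal _ (by positivity), integral_const_mul] at h2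
  -- region
  have hreg : ∀ x : E2, ¬ (1 / 4 + ε ≤ sq2 x ∧ sq2 x ≤ 1 - ε) →
      g (sq2 x) = 0 ∧ deriv g (sq2 x) = 0 := by
    intro x hx
    have h0 : g (sq2 x) = 0 := by
      apply hg0
      by_contra hcon
      push Not at hcon
      exact hx ⟨hcon.1.le, hcon.2.le⟩
    exact ⟨h0, deriv_zero_of_nonneg hgn h0⟩
  have e2 : ∀ x, V x * (Dd 0 (fun x => (Real.exp (U x) * W x * g (sq2 x)) * (x 0 - c 0)) x +
      Dd 1 (fun x => (Real.exp (U x) * W x * g (sq2 x)) * (x 1 - c 1)) x) =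
      V x * W x * Real.exp (U x) * g (sq2 x) *
        ((x 0 - c 0) * Dd 0 U x + (x 1 - c 1) * Dd 1 U x) +
      V x * W x * Real.exp (U x) *
      ((2 + 2 * β) * g (sq2 x) + 2 * deriv g (sq2 x) * yx c x) := by
    intro x
    have hi : ∀ i : Fin 2, Dd i (fun x => (Real.exp (U x) * W x * g (sq2 x)) * (x i - c i)) x =
        (Real.exp (U x) * Dd i U x * W x * g (sq2 x) + Real.exp (U x) * Dd i W x * g (sq2 x) +
          Real.exp (U x) * W x * (2 * deriv g (sq2 x) * x i)) * (x i - c i) +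
        (Real.exp (U x) * W x * g (sq2 x)) := by
      intro i
      rw [Dd_mul (cd_diff hB x) (cd_diff (cd_y c i) x),
        Dd_mul (cd_diff (hE.mul S.hW) x) (cd_diff hχ x), Dd_mul (cd_diff hE x) (cd_diff S.hW x),
        Dd_exp (cd_diff hU1 x), Dd_radial hgd, Dd_y]
      simp
      ring
    rw [hi 0, hi 1]
    by_cases hx : 1 / 4 + ε ≤ sq2 x ∧ sq2 x ≤ 1 - ε
    · have := S.hWd x hx.1 hx.2
      unfold yx
      linear_combination V x * Real.exp (U x) * g (sq2 x) * this
    · obtain ⟨z1, z2⟩ := hreg x hx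
      rw [z1, z2]; ring
  have e1 : ∀ x, (((x 0 - c 0) * Dd 0 U x + (x 1 - c 1) * Dd 1 U x) *
        (Dd 0 (fun x => g (sq2 x)) x * Dd 0 U x + Dd 1 (fun x => g (sq2 x)) x * Dd 1 U x) -
      1 / 2 * ((x 0 - c 0) * Dd 0 (fun x => g (sq2 x)) x +
        (x 1 - c 1) * Dd 1 (fun x => g (sq2 x)) x) * (Dd 0 U x ^ 2 + Dd 1 U x ^ 2) +
      g (sq2 x) * (Dd 0 (Dd 0 U) x + Dd 1 (Dd 1 U) x) *
        ((x 0 - c 0) * Dd 0 U x + (x 1 - c 1) * Dd 1 U x)) =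
      2 * deriv g (sq2 x) * qf c U x - V x * W x * Real.exp (U x) * g (sq2 x) *
        ((x 0 - c 0) * Dd 0 U x + (x 1 - c 1) * Dd 1 U x) := by
    intro x
    rw [Dd_radial hgd, Dd_radial hgd]
    unfold qf
    by_cases hx : 1 / 4 + ε ≤ sq2 x ∧ sq2 x ≤ 1 - ε
    · rw [S.heq x hx.1 hx.2]; ring
    · obtain ⟨z1, z2⟩ := hreg x hx
      rw [z1, z2]; ring
  simp only [e1] at h1
  simp only [e2] at h2
  have i1 : IntegrableOn (fun x => 2 * deriv g (sq2 x) * qf c U x -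
      V x * W x * Real.exp (U x) * g (sq2 x) *
        ((x 0 - c 0) * Dd 0 U x + (x 1 - c 1) * Dd 1 U x)) BB := intBB (by fun_prop)
  have i2 : IntegrableOn (fun x => V x * W x * Real.exp (U x) * g (sq2 x) *
        ((x 0 - c 0) * Dd 0 U x + (x 1 - c 1) * Dd 1 U x) +
      V x * W x * Real.exp (U x) *
      ((2 + 2 * β) * g (sq2 x) + 2 * deriv g (sq2 x) * yx c x)) BB := intBB (by fun_prop)
  have h3 := integral_add i1 i2
  rw [h1, zero_add] at h3
  rw [← h3] at h2
  have e3 : (∫ x in BB, (2 * deriv g (sq2 x) * qf c U x + V x * W x * Real.exp (U x) *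
      ((2 + 2 * β) * g (sq2 x) + 2 * deriv g (sq2 x) * yx c x))) = 
      ∫ x in BB, (2 * deriv g (sq2 x) * qf c U x -
      V x * W x * Real.exp (U x) * g (sq2 x) *
        ((x 0 - c 0) * Dd 0 U x + (x 1 - c 1) * Dd 1 U x) +
      (V x * W x * Real.exp (U x) * g (sq2 x) *
        ((x 0 - c 0) * Dd 0 U x + (x 1 - c 1) * Dd 1 U x) +
      V x * W x * Real.exp (U x) *
      ((2 + 2 * β) * g (sq2 x) + 2 * deriv g (sq2 x) * yx c x))) := by
    congr 1; ext x; ring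
  rw [e3]
  refine h2.trans (le_of_eq ?_)
  ring

lemma flux_id {β a b ε : ℝ} {c : E2} {V U W : E2 → ℝ}
    (S : Setup β a b ε c V U W) {g : ℝ → ℝ} (hg : ContDiff ℝ 1 g)
    (hg0 : ∀ t, t ≤ 1 / 4 + ε ∨ 1 - ε ≤ t → g t = 0) :
    ∫ x in BB, (2 * deriv g (sq2 x) * rad U x - V x * W x * Real.exp (U x) * g (sq2 x)) = 0 := by
  have hεp := S.hε
  have hχ : ContDiff ℝ 1 (fun x : E2 => g (sq2 x)) := hg.comp contDiff_sq2
  have hχ0 : ∀ x : E2, 1 < sq2 x → g (sq2 x) = 0 := fun x hx => hg0 _ (Or.inr (by linarith))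
  have hgd : Differentiable ℝ g := hg.differentiable (by norm_num)
  rw [← ident_flux hχ S.hU hχ0]
  congr 1; ext x
  rw [Dd_radial hgd, Dd_radial hgd]
  unfold rad
  by_cases hx : 1 / 4 + ε ≤ sq2 x ∧ sq2 x ≤ 1 - ε
  · rw [S.heq x hx.1 hx.2]; ring
  · have h0 : g (sq2 x) = 0 := by
      apply hg0
      by_contra hcon
      push Not at hcon
      exact hx ⟨hcon.1.le, hcon.2.le⟩
    rw [h0]; ring

lemma div_id {g : ℝ → ℝ} (hg : ContDiff ℝ 1 g) (hg0 : ∀ t, 1 < t → g t = 0) :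
    ∫ x in BB, (g (sq2 x) + deriv g (sq2 x) * sq2 x) = 0 := by
  have hχ : ContDiff ℝ 1 (fun x : E2 => g (sq2 x)) := hg.comp contDiff_sq2
  have hgd : Differentiable ℝ g := hg.differentiable (by norm_num)
  have h := int_div (F := fun x => g (sq2 x) * x 0) (G := fun x => g (sq2 x) * x 1)
    (hχ.mul (contDiff_coord 0)) (fun x hx => by simp [hg0 _ hx])
    (hχ.mul (contDiff_coord 1)) (fun x hx => by simp [hg0 _ hx])
  have e : ∀ x, Dd 0 (fun x => g (sq2 x) * x 0) x + Dd 1 (fun x => g (sq2 x) * x 1) x =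
      2 * (g (sq2 x) + deriv g (sq2 x) * sq2 x) := by
    intro x
    rw [Dd_mul (cd_diff hχ x) (cd_diff (contDiff_coord 0) x),
      Dd_mul (cd_diff hχ x) (cd_diff (contDiff_coord 1) x), Dd_radial hgd, Dd_radial hgd,
      Dd_coord, Dd_coord]
    simp [sq2]
    ring
  simp only [e] at h
  rw [integral_const_mul] at h
  linarith

/-! pointwise facts -/

lemma yx_lower {c x : E2} (hc : sq2 c = 1 / 4) (hx : 1 / 4 ≤ sq2 x) : 0 ≤ yx c x := by
  have h1 : (c 0 * x 0 + c 1 * x 1) ^ 2 ≤ sq2 c * sq2 x := by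
    unfold sq2; nlinarith [sq_nonneg (c 0 * x 1 - c 1 * x 0)]
  have e : yx c x = sq2 x - (c 0 * x 0 + c 1 * x 1) := by unfold yx sq2; ring
  rw [e, hc] at *
  nlinarith

lemma yx_lower_out {c x : E2} (hc : sq2 c = 1 / 4) (hx : 98 / 100 ≤ sq2 x) :
    48 / 100 ≤ yx c x := by
  have h1 : (c 0 * x 0 + c 1 * x 1) ^ 2 ≤ sq2 c * sq2 x := by
    unfold sq2; nlinarith [sq_nonneg (c 0 * x 1 - c 1 * x 0)]
  have e : yx c x = sq2 x - (c 0 * x 0 + c 1 * x 1) := by unfold yx sq2; ring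
  rw [e, hc] at *
  nlinarith

lemma yx_abs {c x : E2} (hc : sq2 c = 1 / 4) (hx : sq2 x ≤ 1) : |yx c x| ≤ 3 / 2 := by
  have h := y_sq_le hc hx
  apply abs_le_of_sq_le_sq _ (by norm_num)
  have h1 : yx c x ^ 2 ≤ ((x 0 - c 0) ^ 2 + (x 1 - c 1) ^ 2) * sq2 x := by
    unfold yx sq2; nlinarith [sq_nonneg ((x 0 - c 0) * x 1 - (x 1 - c 1) * x 0)]
  have h0 : 0 ≤ sq2 x := by unfold sq2; positivity
  nlinarith

lemma yp_abs {c x : E2} (hc : sq2 c = 1 / 4) (hx : sq2 x ≤ 1) :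
    |(x 1 - c 1) * x 0 - (x 0 - c 0) * x 1| ≤ 3 / 2 := by
  have h := y_sq_le hc hx
  apply abs_le_of_sq_le_sq _ (by norm_num)
  have h1 : ((x 1 - c 1) * x 0 - (x 0 - c 0) * x 1) ^ 2 ≤
      ((x 0 - c 0) ^ 2 + (x 1 - c 1) ^ 2) * sq2 x := by
    unfold sq2; nlinarith [sq_nonneg ((x 0 - c 0) * x 0 + (x 1 - c 1) * x 1)]
  have h0 : 0 ≤ sq2 x := by unfold sq2; positivity
  nlinarith

lemma rad_abs {U : E2 → ℝ} {x : E2} (hx : sq2 x ≤ 1) :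
    |rad U x| ≤ |Dd 0 U x| + |Dd 1 U x| := by
  unfold rad
  refine (abs_add_le _ _).trans ?_
  rw [abs_mul, abs_mul]
  have h0 := coord_le hx 0
  have h1 := coord_le hx 1
  have := abs_nonneg (Dd 0 U x)
  have := abs_nonneg (Dd 1 U x)
  nlinarith

lemma qf_lower {β a b ε : ℝ} {c : E2} {V U W : E2 → ℝ} (S : Setup β a b ε c V U W) {x : E2}
    (h1 : 1 / 4 + ε ≤ sq2 x) (h2 : sq2 x ≤ 1 - ε)
    (h3 : sq2 x ≤ 1 / 4 + 2 * ε ∨ 1 - 2 * ε ≤ sq2 x) :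
    1 / 2 * yx c x * rad U x ^ 2 - 3 / 2 ≤ sq2 x * qf c U x := by
  have hε := S.hε
  have hT := S.hT x h1 h2 h3
  set T := x 0 * Dd 1 U x - x 1 * Dd 0 U x with hTd
  have e : sq2 x * qf c U x = 1 / 2 * yx c x * (rad U x ^ 2 - T ^ 2) +
      T * ((x 1 - c 1) * x 0 - (x 0 - c 0) * x 1) * rad U x := by
    rw [hTd]; unfold sq2 qf yx rad; ring
  have a1 := (abs_le.1 (yx_abs S.hc (x := x) (by linarith))).2
  have a2 := yp_abs S.hc (x := x) (by linarith)
  have a3 := rad_abs (U := U) (x := x) (by linarith)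
  have hx1 : |T * ((x 1 - c 1) * x 0 - (x 0 - c 0) * x 1) * rad U x| ≤
      3 / 2 * (|T| * (|Dd 0 U x| + |Dd 1 U x|)) := by
    rw [abs_mul, abs_mul]
    calc |T| * |(x 1 - c 1) * x 0 - (x 0 - c 0) * x 1| * |rad U x|
        ≤ |T| * (3 / 2) * (|Dd 0 U x| + |Dd 1 U x|) := by gcongr
      _ = _ := by ring
  have hx2 := (abs_le.1 hx1).1
  have hs : T ^ 2 = |T| * |T| := by rw [← sq, sq_abs]
  have hT2 : 0 ≤ T ^ 2 := sq_nonneg _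
  rw [e]
  nlinarith

lemma qf_abs {c : E2} {U : E2 → ℝ} {x : E2} (hc : sq2 c = 1 / 4) (hx : sq2 x ≤ 1) :
    |qf c U x| ≤ 9 / 4 * (Dd 0 U x ^ 2 + Dd 1 U x ^ 2) := by
  set N := Dd 0 U x ^ 2 + Dd 1 U x ^ 2 with hN
  have hN0 : 0 ≤ N := by positivity
  have h := y_sq_le hc hx
  have h1 : |((x 0 - c 0) * Dd 0 U x + (x 1 - c 1) * Dd 1 U x) *
      (x 0 * Dd 0 U x + x 1 * Dd 1 U x)| ≤ 3 / 2 * N := by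
    apply abs_le_of_sq_le_sq _ (by positivity)
    rw [mul_pow, mul_pow]
    have b1 : ((x 0 - c 0) * Dd 0 U x + (x 1 - c 1) * Dd 1 U x) ^ 2 ≤ (3 / 2) ^ 2 * N := by
      have : ((x 0 - c 0) * Dd 0 U x + (x 1 - c 1) * Dd 1 U x) ^ 2 ≤
          ((x 0 - c 0) ^ 2 + (x 1 - c 1) ^ 2) * N := by
        rw [hN]; nlinarith [sq_nonneg ((x 0 - c 0) * Dd 1 U x - (x 1 - c 1) * Dd 0 U x)]
      nlinarith
    have b2 : (x 0 * Dd 0 U x + x 1 * Dd 1 U x) ^ 2 ≤ N := by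
      have : (x 0 * Dd 0 U x + x 1 * Dd 1 U x) ^ 2 ≤ sq2 x * N := by
        rw [hN]; unfold sq2; nlinarith [sq_nonneg (x 0 * Dd 1 U x - x 1 * Dd 0 U x)]
      nlinarith
    calc _ ≤ ((3 / 2) ^ 2 * N) * N := mul_le_mul b1 b2 (sq_nonneg _) (by positivity)
      _ = _ := by ring
  have h2 := yx_abs hc hx
  have e : qf c U x = ((x 0 - c 0) * Dd 0 U x + (x 1 - c 1) * Dd 1 U x) *
      (x 0 * Dd 0 U x + x 1 * Dd 1 U x) - 1 / 2 * yx c x * N := rfl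
  rw [e, abs_le]
  rw [abs_le] at h1 h2
  constructor <;> nlinarith

/-! ### Inner and outer estimates -/

/-- a cutoff profile whose derivative is controlled by the good annulus bump -/
structure Prof (p w G : ℝ) (k : ℝ → ℝ) : Prop where
  cd : ContDiff ℝ 1 k
  nn : ∀ t, 0 ≤ k t
  le : ∀ t, k t ≤ 1
  db : ∀ t, |deriv k t| ≤ G * geta ((t - p) / w) ^ 2

lemma deriv_mul_prof {h k : ℝ → ℝ} (hh : ContDiff ℝ 1 h) (hk : ContDiff ℝ 1 k) (t : ℝ) :
    deriv (fun t => h t * k t) t = deriv h t * k t + h t * deriv k t :=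
  deriv_fun_mul (hh.differentiable (by norm_num) t) (hk.differentiable (by norm_num) t)

lemma kpart {β a b ε : ℝ} (ha : 0 < a) {c : E2} {V U W : E2 → ℝ}
    (S : Setup β a b ε c V U W) {p w G w2 : ℝ} (hw : 0 < w) (hG : 0 ≤ G) (hp : 5 / 10 ≤ p)
    (hpw : p + w ≤ 8 / 10)
    (hw2 : ∀ x, 4 / 10 ≤ sq2 x → sq2 x ≤ 1 → ‖x - c‖ ^ (2 * β) ≤ w2) {x : E2} {D : ℝ}
    (hD : |D| ≤ G * eta p w x ^ 2) :
    |D * (qf c U x + V x * W x * Real.exp (U x) * yx c x)| ≤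
      9 / 4 * G * (eta p w x ^ 2 * Real.exp (U x) * (Dd 0 U x ^ 2 + Dd 1 U x ^ 2)) +
      3 / 2 * G * b * w2 * (eta p w x ^ 2 * Real.exp (U x)) := by
  by_cases hη : eta p w x = 0
  · have : D = 0 := by rw [hη] at hD; simpa using hD
    rw [this, hη]; simp
  · have hsh : x ∈ shell p w := by
      by_contra hcon
      exact hη (eta_zero hw hcon)
    obtain ⟨s1, s2⟩ := hsh
    have hε := S.hε
    have hε' := S.hε'
    have r1 : 1 / 4 + ε ≤ sq2 x := by linarith
    have r2 : sq2 x ≤ 1 - ε := by linarith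
    have hW := S.hWe x r1 r2
    have hW2 : W x ≤ w2 := by rw [hW]; exact hw2 x (by linarith) (by linarith)
    have hW0 := S.hW0 x
    have hV := S.hVa x r1 r2
    have hq := qf_abs (U := U) S.hc (x := x) (by linarith)
    have hy := yx_abs S.hc (x := x) (by linarith)
    have hE : 1 ≤ Real.exp (U x) := Real.one_le_exp (S.hU0 x)
    set E := Real.exp (U x) with hEd
    set N := Dd 0 U x ^ 2 + Dd 1 U x ^ 2 with hN
    have hN0 : 0 ≤ N := by positivity
    have hV0 : 0 ≤ V x := by linarith
    have hb : 0 ≤ b := by linarith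
    have e1 : |V x * W x * E * yx c x| ≤ b * w2 * E * (3 / 2) := by
      rw [abs_mul, abs_of_nonneg (by positivity : 0 ≤ V x * W x * E)]
      have hw20 : 0 ≤ w2 := hW0.trans hW2
      have h1 : V x * W x ≤ b * w2 := mul_le_mul hV.2 hW2 hW0 hb
      have h2 : V x * W x * E ≤ b * w2 * E := by gcongr
      exact mul_le_mul h2 hy (abs_nonneg _) (by positivity)
    have e2 : |qf c U x + V x * W x * E * yx c x| ≤ 9 / 4 * (E * N) + 3 / 2 * b * w2 * E := by
      refine (abs_add_le _ _).trans ?_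
      have : N ≤ E * N := by nlinarith
      linarith
    rw [abs_mul]
    calc |D| * |qf c U x + V x * W x * E * yx c x|
        ≤ (G * eta p w x ^ 2) * (9 / 4 * (E * N) + 3 / 2 * b * w2 * E) := by gcongr
      _ = _ := by ring

lemma eta_sq_le (p w : ℝ) (x : E2) : eta p w x ^ 2 ≤ 1 :=
  pow_le_one₀ (geta_nonneg _) (geta_le_one _)

lemma aux_h3 {s q z : ℝ} (hs : 1 / 4 ≤ s) (hz : 0 ≤ z) (h : z - 3 / 2 ≤ s * q) : -6 ≤ q := by
  by_contra hcon
  push Not at hcon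
  nlinarith

lemma aux_h3o {s q r z : ℝ} (hs : 98 / 100 ≤ s) (hs1 : s ≤ 1) (hz : 24 / 100 * r ^ 2 ≤ z)
    (h : z - 3 / 2 ≤ s * q) : 2 / 10 * r ^ 2 - 2 ≤ q := by
  by_contra hcon
  push Not at hcon
  have := sq_nonneg r
  nlinarith

lemma aux_m1 {d q z : ℝ} (hd : 0 ≤ d) (hz : 0 ≤ z) (hq : -6 ≤ q) :
    -(d * (q + z)) ≤ 6 * d := by nlinarith

lemma aux_m2 {d q z r : ℝ} (hd : 0 ≤ d) (hz : 0 ≤ z) (hq : 2 / 10 * r ^ 2 - 2 ≤ q) :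
    2 / 10 * (d * r ^ 2) - 2 * d ≤ d * (q + z) := by nlinarith

set_option maxHeartbeats 2000000 in
lemma inner_step (β a b : ℝ) (hβ : 0 < β + 1) (ha : 0 < a) (w G C0 : ℝ)
    (hw : 0 < w) (hG : 0 ≤ G) :
    ∃ C > (0:ℝ), ∀ ε c V U W, Setup β a b ε c V U W → ∀ p : ℝ, 5 / 10 ≤ p → p + w ≤ 8 / 10 →
      ∫ x in BB, eta p w x ^ 2 * Real.exp (U x) ≤ C0 →
      ∫ x in BB, eta p w x ^ 2 * Real.exp (U x) * (Dd 0 U x ^ 2 + Dd 1 U x ^ 2) ≤ C0 →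
      ∀ h k : ℝ → ℝ, Prof p w G k → (∀ t, 8 / 10 ≤ t → k t = 0) →
        ContDiff ℝ 1 h → (∀ t, 0 ≤ h t) → (∀ t, h t ≤ 1) → (∀ t, t ≤ 1 / 4 + ε → h t = 0) →
        (∀ t, 0 ≤ deriv h t) → (∀ t, 1 / 4 + 2 * ε < t → deriv h t = 0) →
        ∫ x in BB, W x * Real.exp (U x) * (h (sq2 x) * k (sq2 x)) ≤ C := by
  obtain ⟨w1, hw1, w2, hw2, hwb⟩ := weight_bounds β
  set M0 : ℝ := ∫ x in BB, (1:ℝ) with hM0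
  have hM : 0 ≤ M0 := integral_nonneg fun x => zero_le_one
  set R := 48 * G * M0 + 9 / 2 * G * C0 + 3 * G * b * w2 * C0 with hR
  refine ⟨(5 / 4 * (β + 1) * a)⁻¹ * |R| + 1, by positivity, ?_⟩
  intro ε c V U W S p hp hpw hI1 hI2 h k hk hk0 hh hh0 hh1 hhz hhd hhd0
  by_cases hb : b < a
  · exfalso
    have hε := S.hε
    have hε' := S.hε'
    have := S.hVa (EuclideanSpace.single 0 (7 / 10)) (by simp [sq2]; norm_num; linarith)
      (by simp [sq2]; norm_num; linarith)
    linarith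
  push Not at hb
  have hb0 : 0 ≤ b := by linarith
  have hε := S.hε
  have hε' := S.hε'
  have cU := S.hU.continuous
  have cV : Continuous V := S.hV.continuous
  have cW := S.hW.continuous
  have d0 := (contDiff_Dd S.hU 0).continuous
  have d1 := (contDiff_Dd S.hU 1).continuous
  have cq := continuous_qf (c := c) S.hU
  have cyx := continuous_yx (c := c)
  have ch := hh.continuous
  have ck := hk.cd.continuous
  have cdh : Continuous (deriv h) := hh.continuous_deriv (by norm_num)
  have cdk : Continuous (deriv k) := hk.cd.continuous_deriv (by norm_num)
  have cs := continuous_sq2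
  have cη := (eta_cd p w).continuous
  have hgcd : ContDiff ℝ 1 (fun t => h t * k t) := hh.mul hk.cd
  have hgn : ∀ t, 0 ≤ h t * k t := fun t => mul_nonneg (hh0 t) (hk.nn t)
  have hg0 : ∀ t, t ≤ 1 / 4 + ε ∨ 1 - ε ≤ t → h t * k t = 0 := by
    rintro t (ht | ht)
    · rw [hhz t ht, zero_mul]
    · rw [hk0 t (by linarith), mul_zero]
  have hP := poho_ineq hβ ha S hgcd hgn hg0
  have hD := div_id hgcd (fun t ht => hg0 t (Or.inr (by linarith)))
  simp only [deriv_mul_prof hh hk.cd] at hP hD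
  obtain ⟨K, hKd⟩ : ∃ K : E2 → ℝ, K = fun x => 2 * (deriv h (sq2 x) * k (sq2 x) + h (sq2 x) * deriv k (sq2 x)) * qf c U x +
        V x * W x * Real.exp (U x) * ((2 + 2 * β) * (h (sq2 x) * k (sq2 x)) +
          2 * (deriv h (sq2 x) * k (sq2 x) + h (sq2 x) * deriv k (sq2 x)) * yx c x) := ⟨_, rfl⟩
  have hKx : ∀ x, K x = 2 * (deriv h (sq2 x) * k (sq2 x) + h (sq2 x) * deriv k (sq2 x)) * qf c U x +
        V x * W x * Real.exp (U x) * ((2 + 2 * β) * (h (sq2 x) * k (sq2 x)) +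
          2 * (deriv h (sq2 x) * k (sq2 x) + h (sq2 x) * deriv k (sq2 x)) * yx c x) := fun x => by rw [hKd]
  have cK : Continuous K := by rw [hKd]; fun_prop
  simp only [← hKx] at hP
  have hlow : ∀ t, t ≤ 1 / 4 + ε → deriv h t = 0 := fun t ht =>
    deriv_zero_of_nonneg hh0 (hhz t ht)
  have hkD : ∀ x : E2, |h (sq2 x) * deriv k (sq2 x)| ≤ G * eta p w x ^ 2 := by
    intro x
    rw [abs_mul, abs_of_nonneg (hh0 _)]
    have := hk.db (sq2 x)
    calc h (sq2 x) * |deriv k (sq2 x)| ≤ 1 * |deriv k (sq2 x)| := by gcongr; exact hh1 _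
      _ ≤ _ := by rw [one_mul]; exact this
  -- bound of J
  have hJ : ∫ x in BB, deriv h (sq2 x) * k (sq2 x) ≤ 4 * G * M0 := by
    have m := int_mono_BB (f := fun x => deriv h (sq2 x) * k (sq2 x))
      (g := fun x => 4 * (h (sq2 x) * k (sq2 x) +
        (deriv h (sq2 x) * k (sq2 x) + h (sq2 x) * deriv k (sq2 x)) * sq2 x) + 4 * G * 1)
      (by fun_prop) (by fun_prop) ?_
    · rw [integral_add (intBB (by fun_prop)) (intBB (by fun_prop)), integral_const_mul,
        integral_const_mul, hD] at m
      linarith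
    · intro x hx
      have hx1 : sq2 x ≤ 1 := hx
      have hx0 : 0 ≤ sq2 x := by unfold sq2; positivity
      have a1 := hkD x
      have a2 := eta_sq_le p w x
      have a3 : |h (sq2 x) * deriv k (sq2 x)| ≤ G := by nlinarith
      have a4 := (abs_le.1 a3).1
      have a5 : -G ≤ h (sq2 x) * deriv k (sq2 x) * sq2 x := by nlinarith
      have a6 : deriv h (sq2 x) * k (sq2 x) ≤ 4 * (deriv h (sq2 x) * k (sq2 x) * sq2 x) := by
        by_cases hs : sq2 x ≤ 1 / 4 + ε
        · rw [hlow _ hs]; simp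
        · have : 0 ≤ deriv h (sq2 x) * k (sq2 x) := mul_nonneg (hhd _) (hk.nn _)
          nlinarith
      have := hgn (sq2 x)
      nlinarith
  -- main pointwise inequality
  have m := int_mono_BB (f := fun x => (2 + 2 * β) * a *
        (W x * Real.exp (U x) * (h (sq2 x) * k (sq2 x))) -
      K x)
    (g := fun x => 12 * (deriv h (sq2 x) * k (sq2 x)) +
      (9 / 2 * G * (eta p w x ^ 2 * Real.exp (U x) * (Dd 0 U x ^ 2 + Dd 1 U x ^ 2)) +
      3 * G * b * w2 * (eta p w x ^ 2 * Real.exp (U x)))) (by fun_prop) (by fun_prop) ?_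
  · rw [integral_sub (intBB (by fun_prop)) (intBB (by fun_prop)), integral_const_mul,
      integral_add (intBB (by fun_prop)) (intBB (by fun_prop)), integral_const_mul,
      integral_add (intBB (by fun_prop)) (intBB (by fun_prop)), integral_const_mul,
      integral_const_mul] at m
    have hP2 := (abs_le.1 hP).2
    set mm := ∫ x in BB, W x * Real.exp (U x) * (h (sq2 x) * k (sq2 x)) with hmm
    have k1 : 9 / 2 * G * (∫ x in BB, eta p w x ^ 2 * Real.exp (U x) *
      (Dd 0 U x ^ 2 + Dd 1 U x ^ 2)) ≤ 9 / 2 * G * C0 := by gcongr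
    have k2 : 3 * G * b * w2 * (∫ x in BB, eta p w x ^ 2 * Real.exp (U x)) ≤
      3 * G * b * w2 * C0 := by gcongr
    have k3 : (5 / 4 * (β + 1) * a) * mm ≤ R := by rw [hR]; linarith
    have k4 : (5 / 4 * (β + 1) * a) * mm ≤ |R| := k3.trans (le_abs_self _)
    have k5 : 0 < 5 / 4 * (β + 1) * a := by positivity
    have k6 : mm ≤ (5 / 4 * (β + 1) * a)⁻¹ * |R| := by
      rw [inv_mul_eq_div, le_div_iff₀ k5]; linarith
    linarith
  · intro x hx
    have hx1 : sq2 x ≤ 1 := hx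
    have a1 := kpart ha S hw hG hp hpw (fun x h1 h2 => (hwb c x S.hc h1 h2).2) (hkD x)
    have a2 := (abs_le.1 a1).1
    have b1 : (2 + 2 * β) * a * (W x * Real.exp (U x) * (h (sq2 x) * k (sq2 x))) ≤
        V x * W x * Real.exp (U x) * ((2 + 2 * β) * (h (sq2 x) * k (sq2 x))) := by
      by_cases hs : 1 / 4 + ε ≤ sq2 x ∧ sq2 x ≤ 1 - ε
      · have hV := (S.hVa x hs.1 hs.2).1
        have := S.hW0 x
        have hgg := hgn (sq2 x)
        have : 0 ≤ (2 + 2 * β) * (W x * Real.exp (U x) * (h (sq2 x) * k (sq2 x))) := by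
          have : 0 ≤ 2 + 2 * β := by linarith
          positivity
        nlinarith
      · have : h (sq2 x) * k (sq2 x) = 0 := by
          apply hg0
          by_contra hcon
          push Not at hcon
          exact hs ⟨hcon.1.le, hcon.2.le⟩
        rw [this]; simp
    have b2 : -(deriv h (sq2 x) * k (sq2 x) *
        (qf c U x + V x * W x * Real.exp (U x) * yx c x)) ≤ 6 * (deriv h (sq2 x) * k (sq2 x)) := by
      by_cases hs : 1 / 4 + ε ≤ sq2 x ∧ sq2 x ≤ 1 / 4 + 2 * ε
      · have hq := qf_lower S hs.1 (by linarith) (Or.inl hs.2)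
        have hy := yx_lower S.hc (x := x) (by linarith)
        have hV := (S.hVa x hs.1 (by linarith)).1
        have hW := S.hW0 x
        have hV0 : 0 ≤ V x := by linarith
        have h1 : 0 ≤ V x * W x * Real.exp (U x) * yx c x := by positivity
        have h2 : 0 ≤ 1 / 2 * yx c x * rad U x ^ 2 := by positivity
        have h3 : -6 ≤ qf c U x := aux_h3 (by linarith) h2 hq
        have h4 : 0 ≤ deriv h (sq2 x) * k (sq2 x) := mul_nonneg (hhd _) (hk.nn _)
        exact aux_m1 h4 h1 h3
      · have : deriv h (sq2 x) = 0 := by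
          by_cases h1 : sq2 x ≤ 1 / 4 + ε
          · exact hlow _ h1
          · apply hhd0
            by_contra hcon
            push Not at hcon h1
            exact hs ⟨h1.le, hcon⟩
        rw [this]; simp
    rw [hKx x]
    linarith

set_option maxHeartbeats 2000000 in
lemma outer_step (β a b : ℝ) (hβ : 0 < β + 1) (ha : 0 < a) (w G C0 : ℝ)
    (hw : 0 < w) (hG : 0 ≤ G) :
    ∃ C > (0:ℝ), ∀ ε c V U W, Setup β a b ε c V U W → ∀ p : ℝ, 5 / 10 ≤ p → p + w ≤ 8 / 10 →
      ∫ x in BB, eta p w x ^ 2 * Real.exp (U x) ≤ C0 →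
      ∫ x in BB, eta p w x ^ 2 * Real.exp (U x) * (Dd 0 U x ^ 2 + Dd 1 U x ^ 2) ≤ C0 →
      ∀ h k : ℝ → ℝ, Prof p w G k → (∀ t, t ≤ 5 / 10 → k t = 0) →
        ContDiff ℝ 1 h → (∀ t, 0 ≤ h t) → (∀ t, h t ≤ 1) → (∀ t, 1 - ε ≤ t → h t = 0) →
        (∀ t, deriv h t ≤ 0) → (∀ t, t < 1 - 2 * ε → deriv h t = 0) →
        ∫ x in BB, W x * Real.exp (U x) * (h (sq2 x) * k (sq2 x)) ≤ C := by
  obtain ⟨w1, hw1, w2, hw2, hwb⟩ := weight_bounds β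
  set M0 : ℝ := ∫ x in BB, (1:ℝ) with hM0
  have hM : 0 ≤ M0 := integral_nonneg fun x => zero_le_one
  by_cases hb : b < a
  · refine ⟨1, one_pos, ?_⟩
    intro ε c V U W S
    exfalso
    have hε := S.hε
    have hε' := S.hε'
    have := S.hVa (EuclideanSpace.single 0 (7 / 10)) (by simp [sq2]; norm_num; linarith)
      (by simp [sq2]; norm_num; linarith)
    linarith
  push Not at hb
  have hb0 : 0 < b := by linarith
  set J0 := 2 * (1 + G) * M0 with hJ0
  set K1 := 5 / 2 * (3 / 4 * (β + 1) * a + b * (2 + 2 * β)) with hK1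
  have hK1p : 0 < K1 := by
    have : 0 < 2 + 2 * β := by linarith
    positivity
  set K2 := 5 / 2 * (4 * J0 + 9 / 2 * G * C0 + 3 * G * b * w2 * C0) with hK2
  set lam := 2 * K1 / a with hlam
  have hlamp : 0 < lam := by positivity
  set Q := lam * J0 + K2 / lam + 2 * G * C0 with hQ
  refine ⟨2 / a * |Q| + 1, by positivity, ?_⟩
  intro ε c V U W S p hp hpw hI1 hI2 h k hk hk0 hh hh0 hh1 hhz hhd hhd0
  have hε := S.hε
  have hε' := S.hε'
  have cU := S.hU.continuous
  have cV : Continuous V := S.hV.continuous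
  have cW := S.hW.continuous
  have d0 := (contDiff_Dd S.hU 0).continuous
  have d1 := (contDiff_Dd S.hU 1).continuous
  have cq := continuous_qf (c := c) S.hU
  have cr := continuous_rad S.hU
  have cyx := continuous_yx (c := c)
  have ch := hh.continuous
  have ck := hk.cd.continuous
  have cdh : Continuous (deriv h) := hh.continuous_deriv (by norm_num)
  have cdk : Continuous (deriv k) := hk.cd.continuous_deriv (by norm_num)
  have cs := continuous_sq2
  have cη := (eta_cd p w).continuous
  have hgcd : ContDiff ℝ 1 (fun t => h t * k t) := hh.mul hk.cd
  have hgn : ∀ t, 0 ≤ h t * k t := fun t => mul_nonneg (hh0 t) (hk.nn t)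
  have hg0 : ∀ t, t ≤ 1 / 4 + ε ∨ 1 - ε ≤ t → h t * k t = 0 := by
    rintro t (ht | ht)
    · rw [hk0 t (by linarith), mul_zero]
    · rw [hhz t ht, zero_mul]
  have hP := poho_ineq hβ ha S hgcd hgn hg0
  have hD := div_id hgcd (fun t ht => hg0 t (Or.inr (by linarith)))
  have hF := flux_id S hgcd hg0
  simp only [deriv_mul_prof hh hk.cd] at hP hD hF
  obtain ⟨K, hKd⟩ : ∃ K : E2 → ℝ, K = fun x => 2 * (deriv h (sq2 x) * k (sq2 x) + h (sq2 x) * deriv k (sq2 x)) * qf c U x +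
        V x * W x * Real.exp (U x) * ((2 + 2 * β) * (h (sq2 x) * k (sq2 x)) +
          2 * (deriv h (sq2 x) * k (sq2 x) + h (sq2 x) * deriv k (sq2 x)) * yx c x) := ⟨_, rfl⟩
  have hKx : ∀ x, K x = 2 * (deriv h (sq2 x) * k (sq2 x) + h (sq2 x) * deriv k (sq2 x)) * qf c U x +
        V x * W x * Real.exp (U x) * ((2 + 2 * β) * (h (sq2 x) * k (sq2 x)) +
          2 * (deriv h (sq2 x) * k (sq2 x) + h (sq2 x) * deriv k (sq2 x)) * yx c x) := fun x => by rw [hKd]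
  have cK : Continuous K := by rw [hKd]; fun_prop
  simp only [← hKx] at hP
  have hlow : ∀ t, 1 - ε ≤ t → deriv h t = 0 := fun t ht =>
    deriv_zero_of_nonneg hh0 (hhz t ht)
  have hkD : ∀ x : E2, |h (sq2 x) * deriv k (sq2 x)| ≤ G * eta p w x ^ 2 := by
    intro x
    rw [abs_mul, abs_of_nonneg (hh0 _)]
    have := hk.db (sq2 x)
    calc h (sq2 x) * |deriv k (sq2 x)| ≤ 1 * |deriv k (sq2 x)| := by gcongr; exact hh1 _
      _ ≤ _ := by rw [one_mul]; exact this
  have hreg : ∀ x, ¬ (1 / 4 + ε ≤ sq2 x ∧ sq2 x ≤ 1 - ε) → h (sq2 x) * k (sq2 x) = 0 := by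
    intro x hs
    apply hg0
    by_contra hcon
    push Not at hcon
    exact hs ⟨hcon.1.le, hcon.2.le⟩
  have hreg2 : ∀ x, ¬ (1 - 2 * ε ≤ sq2 x ∧ sq2 x ≤ 1 - ε) → deriv h (sq2 x) = 0 := by
    intro x hs
    by_cases h1 : 1 - ε ≤ sq2 x
    · exact hlow _ h1
    · apply hhd0
      by_contra hcon
      push Not at hcon h1
      exact hs ⟨hcon, h1.le⟩
  -- bound of J
  have hJ : ∫ x in BB, -deriv h (sq2 x) * k (sq2 x) ≤ J0 := by
    have m := int_mono_BB (f := fun x => -deriv h (sq2 x) * k (sq2 x))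
      (g := fun x => -2 * (h (sq2 x) * k (sq2 x) +
        (deriv h (sq2 x) * k (sq2 x) + h (sq2 x) * deriv k (sq2 x)) * sq2 x) + 2 * (1 + G) * 1)
      (by fun_prop) (by fun_prop) ?_
    · rw [integral_add (intBB (by fun_prop)) (intBB (by fun_prop)), integral_const_mul,
        integral_const_mul, hD] at m
      linarith
    · intro x hx
      have hx1 : sq2 x ≤ 1 := hx
      have hx0 : 0 ≤ sq2 x := by unfold sq2; positivity
      have a1 := hkD x
      have a2 := eta_sq_le p w x
      have a3 : |h (sq2 x) * deriv k (sq2 x)| ≤ G := by nlinarith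
      have a4 := (abs_le.1 a3).2
      have a5 : h (sq2 x) * deriv k (sq2 x) * sq2 x ≤ G := by nlinarith
      have a6 : -deriv h (sq2 x) * k (sq2 x) ≤ 2 * (-deriv h (sq2 x) * k (sq2 x) * sq2 x) := by
        by_cases hs : 1 - 2 * ε ≤ sq2 x ∧ sq2 x ≤ 1 - ε
        · have : 0 ≤ -deriv h (sq2 x) * k (sq2 x) :=
            mul_nonneg (by linarith [hhd (sq2 x)]) (hk.nn _)
          nlinarith
        · rw [hreg2 x hs]; simp
      have a7 : h (sq2 x) * k (sq2 x) ≤ 1 := mul_le_one₀ (hh1 _) (hk.nn _) (hk.le _)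
      nlinarith
  set J := ∫ x in BB, -deriv h (sq2 x) * k (sq2 x) with hJd
  set mm := ∫ x in BB, W x * Real.exp (U x) * (h (sq2 x) * k (sq2 x)) with hmm
  have hmm0 : 0 ≤ mm := by
    apply integral_nonneg
    intro x
    exact mul_nonneg (mul_nonneg (S.hW0 x) (Real.exp_pos _).le) (hgn _)
  set R := ∫ x in BB, -deriv h (sq2 x) * k (sq2 x) * rad U x ^ 2 with hRd
  have hVg : ∀ x, a * (W x * Real.exp (U x) * (h (sq2 x) * k (sq2 x))) ≤
      V x * W x * Real.exp (U x) * (h (sq2 x) * k (sq2 x)) ∧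
      V x * W x * Real.exp (U x) * (h (sq2 x) * k (sq2 x)) ≤
      b * (W x * Real.exp (U x) * (h (sq2 x) * k (sq2 x))) := by
    intro x
    by_cases hs : 1 / 4 + ε ≤ sq2 x ∧ sq2 x ≤ 1 - ε
    · have hV := S.hVa x hs.1 hs.2
      have hW := S.hW0 x
      have hgg := hgn (sq2 x)
      have : 0 ≤ (W x * Real.exp (U x) * (h (sq2 x) * k (sq2 x))) := by positivity
      constructor <;> nlinarith
    · rw [hreg x hs]; simp
  -- Pohozaev
  have hR : R ≤ K1 * mm + K2 := by
    have m := int_mono_BB (f := fun x => 4 / 10 * (-deriv h (sq2 x) * k (sq2 x) * rad U x ^ 2) -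
        4 * (-deriv h (sq2 x) * k (sq2 x)))
      (g := fun x => -K x +
        (b * (2 + 2 * β) * (W x * Real.exp (U x) * (h (sq2 x) * k (sq2 x))) +
      (9 / 2 * G * (eta p w x ^ 2 * Real.exp (U x) * (Dd 0 U x ^ 2 + Dd 1 U x ^ 2)) +
      3 * G * b * w2 * (eta p w x ^ 2 * Real.exp (U x))))) (by fun_prop) (by fun_prop) ?_
    · rw [integral_sub (intBB (by fun_prop)) (intBB (by fun_prop)), integral_const_mul,
        integral_const_mul,
        integral_add (intBB (by fun_prop)) (intBB (by fun_prop)), integral_neg,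
        integral_add (intBB (by fun_prop)) (intBB (by fun_prop)), integral_const_mul,
        integral_add (intBB (by fun_prop)) (intBB (by fun_prop)), integral_const_mul,
        integral_const_mul] at m
      have hP2 := (abs_le.1 hP).1
      have k1 : 9 / 2 * G * (∫ x in BB, eta p w x ^ 2 * Real.exp (U x) *
        (Dd 0 U x ^ 2 + Dd 1 U x ^ 2)) ≤ 9 / 2 * G * C0 := by gcongr
      have k2 : 3 * G * b * w2 * (∫ x in BB, eta p w x ^ 2 * Real.exp (U x)) ≤
        3 * G * b * w2 * C0 := by gcongr
      rw [hK1, hK2]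
      linarith
    · intro x hx
      have hx1 : sq2 x ≤ 1 := hx
      have a1 := kpart ha S hw hG hp hpw (fun x h1 h2 => (hwb c x S.hc h1 h2).2) (hkD x)
      have a2 := (abs_le.1 a1).2
      have b1 := (hVg x).2
      have b1' := mul_le_mul_of_nonneg_left b1 (by linarith : 0 ≤ 2 + 2 * β)
      have b2 : 2 / 10 * (-deriv h (sq2 x) * k (sq2 x) * rad U x ^ 2) -
          2 * (-deriv h (sq2 x) * k (sq2 x)) ≤ -deriv h (sq2 x) * k (sq2 x) *
          (qf c U x + V x * W x * Real.exp (U x) * yx c x) := by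
        by_cases hs : 1 - 2 * ε ≤ sq2 x ∧ sq2 x ≤ 1 - ε
        · have hq := qf_lower S (by linarith) hs.2 (Or.inr hs.1)
          have hy := yx_lower_out S.hc (x := x) (by linarith)
          have hV := (S.hVa x (by linarith) hs.2).1
          have hW := S.hW0 x
          have hV0 : 0 ≤ V x := by linarith
          have h1 : 0 ≤ V x * W x * Real.exp (U x) * yx c x := by
            have : 0 ≤ yx c x := by linarith
            positivity
          have h2 : 24 / 100 * rad U x ^ 2 ≤ 1 / 2 * yx c x * rad U x ^ 2 := by
            nlinarith [sq_nonneg (rad U x)]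
          have h3 : 2 / 10 * rad U x ^ 2 - 2 ≤ qf c U x := aux_h3o (by linarith) hx1 h2 hq
          have h4 : 0 ≤ -deriv h (sq2 x) * k (sq2 x) :=
            mul_nonneg (by linarith [hhd (sq2 x)]) (hk.nn _)
          exact aux_m2 h4 h1 h3
        · rw [hreg2 x hs]; simp
      rw [hKx x]
      linarith
  -- flux
  have hflux : a * mm ≤ lam * J + R / lam + 2 * G * C0 := by
    have m := int_mono_BB (f := fun x => a * (W x * Real.exp (U x) * (h (sq2 x) * k (sq2 x))))
      (g := fun x => -(2 * (deriv h (sq2 x) * k (sq2 x) + h (sq2 x) * deriv k (sq2 x)) * rad U x -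
          V x * W x * Real.exp (U x) * (h (sq2 x) * k (sq2 x))) +
        ((lam * (-deriv h (sq2 x) * k (sq2 x)) +
          lam⁻¹ * (-deriv h (sq2 x) * k (sq2 x) * rad U x ^ 2)) +
        (G * (eta p w x ^ 2 * Real.exp (U x)) +
        G * (eta p w x ^ 2 * Real.exp (U x) * (Dd 0 U x ^ 2 + Dd 1 U x ^ 2)))))
      (by fun_prop) (by fun_prop) ?_
    · rw [integral_const_mul,
        integral_add (intBB (by fun_prop)) (intBB (by fun_prop)), integral_neg, hF,
        integral_add (intBB (by fun_prop)) (intBB (by fun_prop)),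
        integral_add (intBB (by fun_prop)) (intBB (by fun_prop)), integral_const_mul,
        integral_const_mul,
        integral_add (intBB (by fun_prop)) (intBB (by fun_prop)), integral_const_mul,
        integral_const_mul] at m
      have k1 : G * (∫ x in BB, eta p w x ^ 2 * Real.exp (U x) *
        (Dd 0 U x ^ 2 + Dd 1 U x ^ 2)) ≤ G * C0 := by gcongr
      have k2 : G * (∫ x in BB, eta p w x ^ 2 * Real.exp (U x)) ≤ G * C0 := by gcongr
      have e : R / lam = lam⁻¹ * R := by rw [div_eq_inv_mul]
      rw [e]
      linarith
    · intro x hx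
      have hx1 : sq2 x ≤ 1 := hx
      have b1 := (hVg x).1
      set A := rad U x with hA
      have hE : 1 ≤ Real.exp (U x) := Real.one_le_exp (S.hU0 x)
      have hN : A ^ 2 ≤ Dd 0 U x ^ 2 + Dd 1 U x ^ 2 := by
        have : A ^ 2 ≤ sq2 x * (Dd 0 U x ^ 2 + Dd 1 U x ^ 2) := by
          rw [hA]; unfold rad sq2; nlinarith [sq_nonneg (x 0 * Dd 1 U x - x 1 * Dd 0 U x)]
        have : 0 ≤ Dd 0 U x ^ 2 + Dd 1 U x ^ 2 := by positivity
        nlinarith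
      have hq : 0 ≤ -deriv h (sq2 x) * k (sq2 x) :=
        mul_nonneg (by linarith [hhd (sq2 x)]) (hk.nn _)
      have b2 : -2 * A ≤ lam + lam⁻¹ * A ^ 2 := by
        have : 0 ≤ lam⁻¹ * (lam + A) ^ 2 := by positivity
        have e : lam⁻¹ * (lam + A) ^ 2 = lam + 2 * A + lam⁻¹ * A ^ 2 := by field_simp; ring
        linarith
      have b3 := mul_le_mul_of_nonneg_left b2 hq
      have b4 : 2 * (h (sq2 x) * deriv k (sq2 x)) * A ≤ G * (eta p w x ^ 2 * Real.exp (U x)) +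
        G * (eta p w x ^ 2 * Real.exp (U x) * (Dd 0 U x ^ 2 + Dd 1 U x ^ 2)) := by
        have h1 := hkD x
        have h2 : 2 * |A| ≤ 1 + A ^ 2 := by nlinarith [sq_nonneg (|A| - 1), sq_abs A]
        calc 2 * (h (sq2 x) * deriv k (sq2 x)) * A
            ≤ |(h (sq2 x) * deriv k (sq2 x))| * (2 * |A|) := by
              have := le_abs_self ((h (sq2 x) * deriv k (sq2 x)) * A)
              rw [abs_mul] at this
              linarith
          _ ≤ (G * eta p w x ^ 2) * (1 * (1 + (Dd 0 U x ^ 2 + Dd 1 U x ^ 2))) := by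
              exact mul_le_mul h1 (by linarith) (by positivity) (by positivity)
          _ ≤ (G * eta p w x ^ 2) * (Real.exp (U x) * (1 + (Dd 0 U x ^ 2 + Dd 1 U x ^ 2))) := by
              gcongr
          _ = _ := by ring
      linarith
  have e1 : lam * J ≤ lam * J0 := by gcongr
  have e2 : R / lam ≤ (K1 * mm + K2) / lam := by gcongr
  have e3 : (K1 * mm + K2) / lam = a / 2 * mm + K2 / lam := by
    rw [hlam]; field_simp
  have e4 : a / 2 * mm ≤ |Q| := by
    refine le_trans ?_ (le_abs_self _)
    rw [hQ]; linarith
  have e5 : mm ≤ 2 / a * |Q| := by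
    rw [div_mul_eq_mul_div, le_div_iff₀ ha]; linarith
  linarith

/-! ### The bound in the regularized setting -/

/-- transition profile inside the good annulus -/
def kk (t : ℝ) : ℝ := Real.smoothTransition (2 * (3 / 4 - t))

lemma kk_cd : ContDiff ℝ 1 kk := by
  unfold kk
  exact (st_cd (n := 1)).comp (by fun_prop)

lemma kk_nn (t : ℝ) : 0 ≤ kk t := Real.smoothTransition.nonneg _

lemma kk_le (t : ℝ) : kk t ≤ 1 := Real.smoothTransition.le_one _

lemma kk_one {t : ℝ} (h : t ≤ 1 / 4) : kk t = 1 :=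
  Real.smoothTransition.one_of_one_le (by linarith)

lemma kk_zero {t : ℝ} (h : 3 / 4 ≤ t) : kk t = 0 :=
  Real.smoothTransition.zero_of_nonpos (by linarith)

lemma deriv_zero_of_le_one {g : ℝ → ℝ} (h : ∀ t, g t ≤ 1) {t : ℝ} (ht : g t = 1) :
    deriv g t = 0 := by
  apply IsLocalMax.deriv_eq_zero
  exact Filter.Eventually.of_forall fun s => by rw [ht]; exact h s

lemma kk_deriv : ∃ G > (0:ℝ), ∀ t, |deriv kk t| ≤ G * geta t ^ 2 := by
  have hc : Continuous (deriv kk) := kk_cd.continuous_deriv (by norm_num)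
  obtain ⟨C, hC⟩ := (isCompact_Icc (a := (0:ℝ)) (b := 1)).exists_bound_of_continuousOn
    hc.continuousOn
  refine ⟨max C 1, by positivity, fun t => ?_⟩
  have hnn : 0 ≤ max C 1 * geta t ^ 2 := by positivity
  by_cases h1 : t ≤ 1 / 4
  · rw [deriv_zero_of_le_one kk_le (kk_one h1), abs_zero]; exact hnn
  by_cases h2 : 3 / 4 ≤ t
  · rw [deriv_zero_of_nonneg kk_nn (kk_zero h2), abs_zero]; exact hnn
  push Not at h1 h2
  rw [geta_one h1.le h2.le, one_pow, mul_one]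
  exact (hC t ⟨by linarith, by linarith⟩).trans (le_max_left _ _)

lemma prof_k {G : ℝ} (hG : ∀ t, |deriv kk t| ≤ G * geta t ^ 2) (p : ℝ) {w : ℝ} (hw : 0 < w) :
    Prof p w (G / w) (fun t => kk ((t - p) / w)) ∧
    Prof p w (G / w) (fun t => 1 - kk ((t - p) / w)) := by
  have h1 : Prof p w (G / w) (fun t => kk ((t - p) / w)) := by
    refine ⟨kk_cd.comp (by fun_prop), fun t => kk_nn _, fun t => kk_le _, fun t => ?_⟩
    rw [deriv_resc (kk_cd.differentiable (by norm_num)), abs_div, abs_of_pos hw]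
    calc _ ≤ G * geta ((t - p) / w) ^ 2 / w := by gcongr; exact hG _
      _ = _ := by ring
  refine ⟨h1, ⟨contDiff_const.sub h1.cd, fun t => by linarith [h1.le t],
    fun t => by linarith [h1.nn t], fun t => ?_⟩⟩
  rw [deriv_const_sub, abs_neg]
  exact h1.db t

/-- the compact core of the annulus -/
def core (ε : ℝ) : Set E2 := {x | 1 / 4 + 2 * ε ≤ sq2 x ∧ sq2 x ≤ 1 - 2 * ε}

lemma isClosed_core (ε : ℝ) : IsClosed (core ε) :=
  (isClosed_le continuous_const continuous_sq2).inter
    (isClosed_le continuous_sq2 continuous_const)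

lemma setup_bound (β a b : ℝ) (hβ : 0 < β + 1) (ha : 0 < a) (hab : a ≤ b) :
    ∃ C > (0:ℝ), ∀ ε c V U W, Setup β a b ε c V U W →
      ∫ x in core ε, ‖x - c‖ ^ (2 * β) * Real.exp (U x) ≤ C := by
  obtain ⟨w, hw, C0, hC0, h3⟩ := step3 β a b ha hab
  obtain ⟨G, hG, hGb⟩ := kk_deriv
  obtain ⟨C1, hC1, hin⟩ := inner_step β a b hβ ha w (G / w) C0 hw (by positivity)
  obtain ⟨C2, hC2, hout⟩ := outer_step β a b hβ ha w (G / w) C0 hw (by positivity)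
  refine ⟨C1 + C2, by positivity, fun ε c V U W S => ?_⟩
  have hε := S.hε
  have hε' := S.hε'
  obtain ⟨p, hp, hpw, hI1, hI2⟩ := h3 ε c V U W S
  obtain ⟨P1, P2⟩ := prof_k hGb p hw
  set k : ℝ → ℝ := fun t => kk ((t - p) / w) with hk
  have hst1 : ContDiff ℝ 1 Real.smoothTransition := st_cd (n := 1)
  set hi : ℝ → ℝ := fun t => Real.smoothTransition ((t - 1 / 4) / ε - 1) with hhi
  set ho : ℝ → ℝ := fun t => Real.smoothTransition ((1 - t) / ε - 1) with hho
  have hi_one : ∀ t, 1 / 4 + 2 * ε ≤ t → hi t = 1 := fun t ht => by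
    apply Real.smoothTransition.one_of_one_le
    have : 2 ≤ (t - 1 / 4) / ε := by rw [le_div_iff₀ hε]; linarith
    linarith
  have ho_one : ∀ t, t ≤ 1 - 2 * ε → ho t = 1 := fun t ht => by
    apply Real.smoothTransition.one_of_one_le
    have : 2 ≤ (1 - t) / ε := by rw [le_div_iff₀ hε]; linarith
    linarith
  have hi_zero : ∀ t, t ≤ 1 / 4 + ε → hi t = 0 := fun t ht => by
    apply Real.smoothTransition.zero_of_nonpos
    have : (t - 1 / 4) / ε ≤ 1 := by rw [div_le_iff₀ hε]; linarith
    linarith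
  have ho_zero : ∀ t, 1 - ε ≤ t → ho t = 0 := fun t ht => by
    apply Real.smoothTransition.zero_of_nonpos
    have : (1 - t) / ε ≤ 1 := by rw [div_le_iff₀ hε]; linarith
    linarith
  have hi_le : ∀ t, hi t ≤ 1 := fun t => Real.smoothTransition.le_one _
  have ho_le : ∀ t, ho t ≤ 1 := fun t => Real.smoothTransition.le_one _
  have hi_nn : ∀ t, 0 ≤ hi t := fun t => Real.smoothTransition.nonneg _
  have ho_nn : ∀ t, 0 ≤ ho t := fun t => Real.smoothTransition.nonneg _
  have hi_cd : ContDiff ℝ 1 hi := hst1.comp (by fun_prop)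
  have ho_cd : ContDiff ℝ 1 ho := hst1.comp (by fun_prop)
  have hi_mono : Monotone hi := fun s t hst => by
    apply Real.smoothTransition.monotone
    gcongr
  have ho_anti : Antitone ho := fun s t hst => by
    apply Real.smoothTransition.monotone
    gcongr
  have k0 : ∀ t, 8 / 10 ≤ t → k t = 0 := fun t ht => by
    apply kk_zero
    rw [le_div_iff₀ hw]; nlinarith
  have k1 : ∀ t, t ≤ 5 / 10 → 1 - k t = 0 := fun t ht => by
    have : k t = 1 := by
      apply kk_one
      rw [div_le_iff₀ hw]; nlinarith
    linarith
  have A1 := hin ε c V U W S p hp hpw hI1 hI2 hi k P1 k0 hi_cd hi_nn hi_le hi_zero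
    (fun t => hi_mono.deriv_nonneg)
    (fun t ht => deriv_zero_of_le_one hi_le (hi_one t ht.le))
  have A2 := hout ε c V U W S p hp hpw hI1 hI2 ho (fun t => 1 - k t) P2 k1 ho_cd ho_nn ho_le
    ho_zero (fun t => ho_anti.deriv_nonpos)
    (fun t ht => deriv_zero_of_le_one ho_le (ho_one t ht.le))
  have cU := S.hU.continuous
  have cW := S.hW.continuous
  have chi := hi_cd.continuous
  have cho := ho_cd.continuous
  have ck := P1.cd.continuous
  have cs := continuous_sq2
  set F : E2 → ℝ := fun x => W x * Real.exp (U x) * (hi (sq2 x) * k (sq2 x)) +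
    W x * Real.exp (U x) * (ho (sq2 x) * (1 - k (sq2 x))) with hF
  have cF : Continuous F := by rw [hF]; fun_prop
  have hFn : ∀ x, 0 ≤ F x := fun x => by
    have := S.hW0 x
    have h1 := hi_nn (sq2 x)
    have h2 := ho_nn (sq2 x)
    have h3 := P1.nn (sq2 x)
    have h4 := P2.nn (sq2 x)
    have : 0 ≤ W x * Real.exp (U x) := by positivity
    exact add_nonneg (mul_nonneg this (mul_nonneg h1 h3)) (mul_nonneg this (mul_nonneg h2 h4))
  have hsum : ∫ x in BB, F x ≤ C1 + C2 := by
    rw [hF, integral_add (intBB (by fun_prop)) (intBB (by fun_prop))]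
    linarith
  have hsub : core ε ⊆ BB := fun x hx => by
    have := hx.2
    show sq2 x ≤ 1
    linarith
  calc ∫ x in core ε, ‖x - c‖ ^ (2 * β) * Real.exp (U x) = ∫ x in core ε, F x := by
        apply setIntegral_congr_fun (isClosed_core ε).measurableSet
        intro x hx
        obtain ⟨x1, x2⟩ := hx
        simp only [hF]
        rw [hi_one _ x1, ho_one _ x2, S.hWe x (by linarith) (by linarith)]
        ring
    _ ≤ ∫ x in BB, F x := by
        apply setIntegral_mono_set (intBB cF)
        · exact Filter.Eventually.of_forall hFn
        · exact hsub.eventuallyLE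
    _ ≤ _ := hsum

/-! ### Reduction of the classical problem to the regularized setting -/

open Filter Topology in
lemma mem_Omega {x : E2} : x ∈ Omega ↔ 1 / 4 < sq2 x ∧ sq2 x < 1 := by
  simp only [Omega, ann, Set.mem_ofPred_eq, ← sq2_eq]
  have := norm_nonneg x
  constructor
  · rintro ⟨h1, h2⟩; constructor <;> nlinarith
  · rintro ⟨h1, h2⟩; constructor <;> nlinarith

lemma isOpen_Omega : IsOpen Omega := by
  have : Omega = {x | 1 / 4 < sq2 x} ∩ {x | sq2 x < 1} := by
    ext x; exact mem_Omega
  rw [this]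
  exact (isOpen_lt continuous_const continuous_sq2).inter
    (isOpen_lt continuous_sq2 continuous_const)

lemma mem_closure_Omega {x : E2} : x ∈ closure Omega ↔ 1 / 4 ≤ sq2 x ∧ sq2 x ≤ 1 := by
  constructor
  · intro h
    have hcl : IsClosed ({x : E2 | 1 / 4 ≤ sq2 x} ∩ {x | sq2 x ≤ 1}) :=
      (isClosed_le continuous_const continuous_sq2).inter
        (isClosed_le continuous_sq2 continuous_const)
    have hsub : Omega ⊆ {x : E2 | 1 / 4 ≤ sq2 x} ∩ {x | sq2 x ≤ 1} :=
      fun y hy => ⟨(mem_Omega.1 hy).1.le, (mem_Omega.1 hy).2.le⟩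
    exact closure_minimal hsub hcl h
  · rintro ⟨h1, h2⟩
    rw [← sq2_eq] at h1 h2
    have h0 := norm_nonneg x
    have h3 : 1 / 2 ≤ ‖x‖ := by nlinarith
    have h4 : ‖x‖ ≤ 1 := by nlinarith
    have hx0 : ‖x‖ ≠ 0 := by linarith
    have hm : ‖x‖ ∈ closure (Set.Ioo (1 / 2 : ℝ) 1) := by
      rw [closure_Ioo (by norm_num)]; exact ⟨h3, h4⟩
    have hf : Continuous (fun r : ℝ => (r / ‖x‖) • x) := by fun_prop
    have := map_mem_closure hf hm (t := Omega) (fun r hr => by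
      simp only [Omega, ann, Set.mem_ofPred_eq, norm_smul, norm_div, norm_norm]
      rw [div_mul_cancel₀ _ hx0, Real.norm_eq_abs, abs_of_pos (by linarith [hr.1])]
      exact hr)
    simpa [div_self hx0] using this

lemma isCompact_closure_Omega : IsCompact (closure Omega) := by
  apply isCompact_BB.of_isClosed_subset isClosed_closure
  intro x hx
  exact (mem_closure_Omega.1 hx).2

lemma mem_frontier_Omega {x : E2} : x ∈ frontier Omega ↔ sq2 x = 1 / 4 ∨ sq2 x = 1 := by
  rw [isOpen_Omega.frontier_eq, Set.mem_sdiff, mem_closure_Omega, mem_Omega]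
  constructor
  · rintro ⟨⟨h1, h2⟩, h3⟩
    by_contra! h
    exact h3 ⟨lt_of_le_of_ne h1 (Ne.symm h.1), lt_of_le_of_ne h2 h.2⟩
  · rintro (h | h) <;> rw [h] <;> norm_num

lemma cda_of_sol {u : E2 → ℝ} (hu : ContDiffOn ℝ 2 u (closure Omega)) {x : E2} (hx : x ∈ Omega) :
    ContDiffAt ℝ 2 u x :=
  hu.contDiffAt (Filter.mem_of_superset (isOpen_Omega.mem_nhds hx) subset_closure)

lemma not_locmin_of_neg {u : E2 → ℝ} {x : E2} (hu : ContDiffAt ℝ 2 u x) (i : Fin 2)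
    (hn : Dd i (Dd i u) x < 0) : ¬ IsLocalMin u x := by
  intro hmin
  set e : E2 := EuclideanSpace.single i 1
  have hl : ∀ t : ℝ, HasDerivAt (fun t : ℝ => x + t • e) e t := fun t => by
    simpa using ((hasDerivAt_id t).smul_const e).const_add x
  have hlc : Continuous (fun t : ℝ => x + t • e) := by fun_prop
  have hl0 : x + (0:ℝ) • e = x := by simp
  have htend : Filter.Tendsto (fun t : ℝ => x + t • e) (nhds 0) (nhds x) := by
    have := hlc.tendsto 0
    rwa [hl0] at this
  have hd : ∀ᶠ y in nhds x, DifferentiableAt ℝ u y :=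
    (hu.eventually (by simp)).mono fun y hy => hy.differentiableAt (by norm_num)
  have h1 : deriv (fun t : ℝ => u (x + t • e)) =ᶠ[nhds 0] fun t => Dd i u (x + t • e) := by
    filter_upwards [htend.eventually hd] with t ht
    exact (ht.hasFDerivAt.comp_hasDerivAt t (hl t)).deriv
  have h2 : DifferentiableAt ℝ (Dd i u) x := by
    have h3 : ContDiffAt ℝ 1 (fderiv ℝ u) x := hu.fderiv_right (by norm_num)
    exact (h3.clm_apply contDiffAt_const).differentiableAt (by norm_num)
  have h3 : deriv (deriv (fun t : ℝ => u (x + t • e))) 0 = Dd i (Dd i u) x := by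
    rw [h1.deriv_eq]
    have h4 : HasFDerivAt (Dd i u) (fderiv ℝ (Dd i u) x) (x + (0:ℝ) • e) := by
      rw [hl0]; exact h2.hasFDerivAt
    exact (h4.comp_hasDerivAt (0:ℝ) (hl 0)).deriv
  have hlm : IsLocalMin (fun t : ℝ => u (x + t • e)) 0 := by
    have := htend.eventually hmin
    unfold IsLocalMin IsMinFilter
    simp only [hl0]
    exact this
  have hcont : ContinuousAt (fun t : ℝ => u (x + t • e)) 0 := by
    apply ContinuousAt.comp (g := u) _ hlc.continuousAt
    rw [hl0]; exact hu.continuousAt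
  have hlM := isLocalMax_of_deriv_deriv_neg (by rw [h3]; exact hn) hlm.deriv_eq_zero hcont
  have hc : (fun t : ℝ => u (x + t • e)) =ᶠ[nhds 0] fun _ => u (x + (0:ℝ) • e) := by
    filter_upwards [hlm, hlM] with t h5 h6 using le_antisymm h6 h5
  have h7 : deriv (deriv (fun t : ℝ => u (x + t • e))) 0 = 0 := by
    rw [hc.deriv.deriv_eq]; simp
  rw [h3] at h7
  linarith

lemma sol_nonneg {β a : ℝ} {x₀ : E2} (hx₀ : sq2 x₀ = 1 / 4) {V u : E2 → ℝ} (ha : 0 < a)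
    (hV : ∀ x ∈ Omega, a ≤ V x) (hu : IsSolPbeta β x₀ V u) : ∀ x ∈ closure Omega, 0 ≤ u x := by
  obtain ⟨h1, h2, h3⟩ := hu
  intro x hx
  obtain ⟨z, hz, hmin⟩ := isCompact_closure_Omega.exists_isMinOn ⟨x, hx⟩ h1.continuousOn
  refine le_trans ?_ (hmin hx)
  by_contra! hneg
  by_cases hzO : z ∈ Omega
  · have hcd := cda_of_sol h1 hzO
    have hlm : IsLocalMin u z := hmin.isLocalMin
      (Filter.mem_of_superset (isOpen_Omega.mem_nhds hzO) subset_closure)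
    have h4 := h3 z hzO
    have hne : 0 < ‖z - x₀‖ := by
      rw [norm_pos_iff, sub_ne_zero]
      rintro rfl
      have := (mem_Omega.1 hzO).1
      linarith
    have h5 : 0 < ‖z - x₀‖ ^ (2 * β) * V z * Real.exp (u z) := by
      have := hV z hzO
      have : 0 < V z := by linarith
      positivity
    rw [lap_eq hcd] at h4
    by_cases h6 : Dd 0 (Dd 0 u) z < 0
    · exact not_locmin_of_neg hcd 0 h6 hlm
    · exact not_locmin_of_neg hcd 1 (by linarith) hlm
  · have : z ∈ frontier Omega := by rw [isOpen_Omega.frontier_eq]; exact ⟨hz, hzO⟩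
    rw [h2 z this] at hneg
    exact lt_irrefl _ hneg

/-- rotation by a quarter turn -/
def perp (x : E2) : E2 := x 0 • EuclideanSpace.single 1 1 - x 1 • EuclideanSpace.single 0 1

lemma perp_zero (x : E2) : perp x 0 = - x 1 := by simp [perp]
lemma perp_one (x : E2) : perp x 1 = x 0 := by simp [perp]

lemma tang_zero {u : E2 → ℝ} (h2 : ∀ x ∈ frontier Omega, u x = 0) {z : E2}
    (hz : z ∈ frontier Omega) {L : E2 →L[ℝ] ℝ} (hL : HasFDerivWithinAt u L (closure Omega) z) :
    L (perp z) = 0 := by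
  set γ : ℝ → E2 := fun t => Real.cos t • z + Real.sin t • perp z with hγ
  have hγ0 : γ 0 = z := by simp [hγ]
  have hs : ∀ t, sq2 (γ t) = sq2 z := by
    intro t
    have := Real.sin_sq_add_cos_sq t
    simp only [hγ, sq2, PiLp.add_apply, PiLp.smul_apply, smul_eq_mul, perp_zero, perp_one]
    linear_combination (z 0 ^ 2 + z 1 ^ 2) * this
  have hfr : ∀ t, γ t ∈ frontier Omega := fun t => by
    rw [mem_frontier_Omega, hs]; exact mem_frontier_Omega.1 hz
  have hd : HasDerivAt γ (perp z) 0 := by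
    have := ((Real.hasDerivAt_cos 0).smul_const z).add ((Real.hasDerivAt_sin 0).smul_const (perp z))
    simp only [Real.sin_zero, Real.cos_zero, neg_zero, zero_smul, zero_add, one_smul] at this
    exact this
  have h3 : HasDerivWithinAt (u ∘ γ) (L (perp z)) Set.univ 0 := by
    apply HasFDerivWithinAt.comp_hasDerivWithinAt (t := closure Omega)
    · rw [hγ0]; exact hL
    · exact hd.hasDerivWithinAt
    · intro t _; exact frontier_subset_closure (hfr t)
  have h4 : u ∘ γ = fun _ => 0 := by ext t; exact h2 _ (hfr t)
  rw [h4, hasDerivWithinAt_univ] at h3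
  exact h3.unique (hasDerivAt_const _ _)

/-- the boundary error -/
def Phi (u : E2 → ℝ) (x : E2) : ℝ :=
  |x 0 * Dd 1 u x - x 1 * Dd 0 u x| *
      (|x 0 * Dd 1 u x - x 1 * Dd 0 u x| + |Dd 0 u x| + |Dd 1 u x|)

open Filter Topology in
lemma Phi_small {u : E2 → ℝ} (h1 : ContDiffOn ℝ 2 u (closure Omega))
    (h2 : ∀ x ∈ frontier Omega, u x = 0) {z : E2} (hz : z ∈ frontier Omega) :
    ∀ᶠ x in 𝓝 z, x ∈ Omega → Phi u x ≤ 1 := by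
  have hzc := frontier_subset_closure hz
  have h3 : ContDiffWithinAt ℝ (1 + 1) u (closure Omega) z := by
    have := h1 z hzc
    norm_num
    exact this
  obtain ⟨v, hv, -, -, f', hf', hfc⟩ := (contDiffWithinAt_succ_iff_hasFDerivWithinAt'
    (by simp)).1 h3
  rw [Set.insert_eq_of_mem hzc] at hv
  have hzv : z ∈ v := mem_of_mem_nhdsWithin hzc hv
  have ht := tang_zero h2 hz (hf' z hzv)
  have hfd : ∀ᶠ x in 𝓝[Omega] z, f' x = fderiv ℝ u x := by
    have hv' := nhdsWithin_mono z subset_closure hv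
    filter_upwards [hv', self_mem_nhdsWithin] with x hx hxO
    exact ((hf' x hx).hasFDerivAt
      (Filter.mem_of_superset (isOpen_Omega.mem_nhds hxO) subset_closure)).fderiv.symm
  have hc : Tendsto f' (𝓝[Omega] z) (𝓝 (f' z)) :=
    hfc.continuousWithinAt.mono_left (nhdsWithin_mono z subset_closure)
  have hc2 : Tendsto (fderiv ℝ u) (𝓝[Omega] z) (𝓝 (f' z)) := hc.congr' hfd
  have hD : ∀ i, Tendsto (Dd i u) (𝓝[Omega] z) (𝓝 (f' z (EuclideanSpace.single i 1))) := fun i =>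
    ((ContinuousLinearMap.apply ℝ ℝ (EuclideanSpace.single i 1 : E2)).continuous.tendsto _).comp hc2
  have hx : ∀ i, Tendsto (fun x : E2 => x i) (𝓝[Omega] z) (𝓝 (z i)) := fun i =>
    ((contDiff_coord (n := 1) i).continuous.tendsto z).mono_left nhdsWithin_le_nhds
  have hT : Tendsto (fun x => x 0 * Dd 1 u x - x 1 * Dd 0 u x) (𝓝[Omega] z) (𝓝 0) := by
    have := ((hx 0).mul (hD 1)).sub ((hx 1).mul (hD 0))
    have e : f' z (perp z) = z 0 * f' z (EuclideanSpace.single 1 1)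
      - z 1 * f' z (EuclideanSpace.single 0 1) := by simp [perp]
    rw [← e, ht] at this
    exact this
  have hP : Tendsto (Phi u) (𝓝[Omega] z) (𝓝 0) := by
    have := hT.abs.mul ((hT.abs.add (hD 0).abs).add (hD 1).abs)
    rw [abs_zero, zero_mul] at this
    exact this
  exact eventually_nhdsWithin_iff.1 (hP.eventually (Iic_mem_nhds one_pos))

lemma Phi_collar {u : E2 → ℝ} (h1 : ContDiffOn ℝ 2 u (closure Omega))
    (h2 : ∀ x ∈ frontier Omega, u x = 0) :
    ∃ δ > (0:ℝ), ∀ x ∈ Omega, (sq2 x < 1 / 4 + δ ∨ 1 - δ < sq2 x) → Phi u x ≤ 1 := by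
  set O : Set E2 := interior {x | x ∈ Omega → Phi u x ≤ 1} with hO
  have hfr : ∀ z ∈ frontier Omega, z ∈ O := fun z hz => by
    rw [hO, mem_interior_iff_mem_nhds]; exact Phi_small h1 h2 hz
  have hK : IsCompact (closure Omega \ O) := isCompact_closure_Omega.diff isOpen_interior
  have hg : Continuous (fun x => min (sq2 x - 1 / 4) (1 - sq2 x)) :=
    (continuous_sq2.sub continuous_const).min (continuous_const.sub continuous_sq2)
  have key : ∃ δ > (0:ℝ), ∀ x ∈ closure Omega \ O, δ ≤ min (sq2 x - 1 / 4) (1 - sq2 x) := by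
    rcases (closure Omega \ O).eq_empty_or_nonempty with he | hne
    · exact ⟨1, one_pos, fun x hx => by rw [he] at hx; exact absurd hx (Set.notMem_empty x)⟩
    · obtain ⟨z, hz, hmin⟩ := hK.exists_isMinOn hne hg.continuousOn
      refine ⟨_, ?_, fun x hx => hmin hx⟩
      have hzO : z ∈ Omega := by
        by_contra h
        exact hz.2 (hfr z (by rw [isOpen_Omega.frontier_eq]; exact ⟨hz.1, h⟩))
      have := mem_Omega.1 hzO
      exact lt_min (by linarith) (by linarith)
  obtain ⟨δ, hδ, hmin⟩ := key
  refine ⟨δ, hδ, fun x hx hs => ?_⟩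
  by_cases hxO : x ∈ O
  · exact interior_subset hxO hx
  · have := hmin x ⟨subset_closure hx, hxO⟩
    have h3 := this.trans (min_le_left _ _)
    have h4 := this.trans (min_le_right _ _)
    rcases hs with h | h <;> linarith

/-- cutoff profile away from the boundary -/
def tau (ε t : ℝ) : ℝ :=
  Real.smoothTransition ((t - 1 / 4) * 4 / ε - 1) * Real.smoothTransition ((1 - t) * 4 / ε - 1)

lemma tau_cd (ε : ℝ) : ContDiff ℝ 2 (tau ε) := by
  have h : ContDiff ℝ 2 Real.smoothTransition := st_cd (n := 2)
  exact (h.comp (by fun_prop)).mul (h.comp (by fun_prop))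

lemma tau_nn (ε t : ℝ) : 0 ≤ tau ε t :=
  mul_nonneg (Real.smoothTransition.nonneg _) (Real.smoothTransition.nonneg _)

lemma tau_zero {ε t : ℝ} (hε : 0 < ε) (h : t ≤ 1 / 4 + ε / 4 ∨ 1 - ε / 4 ≤ t) : tau ε t = 0 := by
  unfold tau
  rcases h with h | h
  · rw [Real.smoothTransition.zero_of_nonpos, zero_mul]
    have : (t - 1 / 4) * 4 / ε ≤ 1 := by rw [div_le_one hε]; linarith
    linarith
  · rw [Real.smoothTransition.zero_of_nonpos (x := (1 - t) * 4 / ε - 1), mul_zero]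
    have : (1 - t) * 4 / ε ≤ 1 := by rw [div_le_one hε]; linarith
    linarith

lemma tau_one {ε t : ℝ} (hε : 0 < ε) (h : 1 / 4 + ε / 2 ≤ t) (h' : t ≤ 1 - ε / 2) :
    tau ε t = 1 := by
  unfold tau
  rw [Real.smoothTransition.one_of_one_le, Real.smoothTransition.one_of_one_le, one_mul]
  · have : 2 ≤ (1 - t) * 4 / ε := by rw [le_div_iff₀ hε]; linarith
    linarith
  · have : 2 ≤ (t - 1 / 4) * 4 / ε := by rw [le_div_iff₀ hε]; linarith
    linarith

lemma cut_cd {ε : ℝ} (hε : 0 < ε) {n : WithTop ℕ∞} (hn : n ≤ 2) {f : E2 → ℝ}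
    (hf : ∀ x ∈ Omega, ContDiffAt ℝ n f x) : ContDiff ℝ n (fun x => tau ε (sq2 x) * f x) := by
  rw [contDiff_iff_contDiffAt]
  intro x
  by_cases hx : x ∈ Omega
  · exact ((((tau_cd ε).of_le hn).comp contDiff_sq2).contDiffAt).mul (hf x hx)
  · have hz : (fun x => tau ε (sq2 x) * f x) =ᶠ[nhds x] fun _ => 0 := by
      have hopen : IsOpen {y : E2 | sq2 y < 1 / 4 + ε / 4 ∨ 1 - ε / 4 < sq2 y} :=
        (isOpen_lt continuous_sq2 continuous_const).union
          (isOpen_lt continuous_const continuous_sq2)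
      have hm : x ∈ {y : E2 | sq2 y < 1 / 4 + ε / 4 ∨ 1 - ε / 4 < sq2 y} := by
        rw [mem_Omega] at hx
        by_contra h
        simp only [Set.mem_ofPred_eq] at h
        push Not at h
        exact hx ⟨by linarith [h.1], by linarith [h.2]⟩
      filter_upwards [hopen.mem_nhds hm] with y hy
      rw [tau_zero hε (hy.imp le_of_lt le_of_lt), zero_mul]
    exact contDiffAt_const.congr_of_eventuallyEq hz

lemma cut_eq {ε : ℝ} (hε : 0 < ε) (f : E2 → ℝ) {x : E2} (h1 : 1 / 4 + ε ≤ sq2 x)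
    (h2 : sq2 x ≤ 1 - ε) : (fun x => tau ε (sq2 x) * f x) =ᶠ[nhds x] f := by
  have hopen : IsOpen ({y : E2 | 1 / 4 + ε / 2 < sq2 y} ∩ {y | sq2 y < 1 - ε / 2}) :=
    (isOpen_lt continuous_const continuous_sq2).inter
      (isOpen_lt continuous_sq2 continuous_const)
  have hm : x ∈ {y : E2 | 1 / 4 + ε / 2 < sq2 y} ∩ {y | sq2 y < 1 - ε / 2} :=
    ⟨by simp only [Set.mem_ofPred_eq]; linarith, by simp only [Set.mem_ofPred_eq]; linarith⟩
  filter_upwards [hopen.mem_nhds hm] with y hy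
  rw [tau_one hε (le_of_lt hy.1) (le_of_lt hy.2), one_mul]

lemma Dd_congr_ev {f g : E2 → ℝ} {x : E2} (h : f =ᶠ[nhds x] g) (i : Fin 2) :
    Dd i f =ᶠ[nhds x] Dd i g := by
  filter_upwards [h.eventuallyEq_nhds] with y hy using Dd_congr hy i

lemma weight_eq (β : ℝ) (c x : E2) : ‖x - c‖ ^ (2 * β) = sq2 (x - c) ^ β := by
  rw [← sq2_eq, Real.rpow_mul (norm_nonneg _)]; norm_num

lemma sq2_sub_pos {c x : E2} (h : x ≠ c) : 0 < sq2 (x - c) := by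
  rw [← sq2_eq]
  have : 0 < ‖x - c‖ := by rw [norm_pos_iff, sub_ne_zero]; exact h
  positivity

lemma weight_cd {n : WithTop ℕ∞} (β : ℝ) {c x : E2} (h : x ≠ c) :
    ContDiffAt ℝ n (fun y => ‖y - c‖ ^ (2 * β)) x := by
  simp_rw [weight_eq]
  apply ContDiffAt.rpow_const_of_ne
  · exact (contDiff_sq2.comp (contDiff_id.sub contDiff_const)).contDiffAt
  · exact (sq2_sub_pos h).ne'

lemma weight_euler (β : ℝ) {c x : E2} (h : x ≠ c) :
    (x 0 - c 0) * Dd 0 (fun y => ‖y - c‖ ^ (2 * β)) x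
      + (x 1 - c 1) * Dd 1 (fun y => ‖y - c‖ ^ (2 * β)) x = 2 * β * ‖x - c‖ ^ (2 * β) := by
  simp_rw [weight_eq]
  have hp := sq2_sub_pos h
  have hd : DifferentiableAt ℝ (fun y : E2 => sq2 (y - c)) x :=
    (contDiff_sq2.comp (contDiff_id.sub contDiff_const)).differentiable (n := 1) (by norm_num) x
  have hs : ∀ i, Dd i (fun y : E2 => sq2 (y - c)) x = 2 * (x i - c i) := by
    intro i
    have := Dd_sq2 (x - c) i
    unfold Dd at this ⊢
    rw [fderiv_comp_sub, this]
    simp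
  have hD : ∀ i, Dd i (fun y : E2 => sq2 (y - c) ^ β) x
      = β * sq2 (x - c) ^ (β - 1) * (2 * (x i - c i)) := by
    intro i
    rw [Dd_comp (g := fun t => t ^ β) hd (Real.differentiableAt_rpow_const_of_ne β hp.ne'),
      Real.deriv_rpow_const, hs]
  rw [hD, hD]
  have h2 : sq2 (x - c) ^ β = sq2 (x - c) ^ (β - 1) * sq2 (x - c) := by
    rw [← Real.rpow_add_one hp.ne']; ring_nf
  rw [h2]
  nth_rw 4 [sq2]
  simp only [PiLp.sub_apply]
  ring

lemma setup_of_sol {β a b : ℝ} {x₀ : E2} (hx₀ : sq2 x₀ = 1 / 4) {V u : E2 → ℝ} (ha : 0 < a)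
    (hLip : LipschitzOnWith (Real.toNNReal ((β + 1) * a / 2)) V (closure Omega))
    (hV : ∀ x ∈ closure Omega, a ≤ V x ∧ V x ≤ b) (hu : IsSolPbeta β x₀ V u) :
    ∃ δ > (0:ℝ), ∀ ε, 0 < ε → ε < δ → ∃ V' U W, Setup β a b ε x₀ V' U W ∧
      ∀ x ∈ core ε, U x = u x := by
  have hnn := sol_nonneg hx₀ ha (fun x hx => (hV x (subset_closure hx)).1) hu
  obtain ⟨h1, h2, h3⟩ := hu
  obtain ⟨δ, hδ, hPhi⟩ := Phi_collar h1 h2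
  obtain ⟨V', hV'L, hV'e⟩ := hLip.extend_real
  have hneq : ∀ x ∈ Omega, x ≠ x₀ := by
    rintro x hx rfl
    have := (mem_Omega.1 hx).1
    linarith
  refine ⟨min (δ / 2) (1 / 100), by positivity, fun ε hε hεδ => ?_⟩
  have hε1 : 2 * ε < δ := by have := hεδ.trans_le (min_le_left _ _); linarith
  have hε2 : ε ≤ 1 / 100 := (hεδ.trans_le (min_le_right _ _)).le
  have hreg : ∀ x : E2, 1 / 4 + ε ≤ sq2 x → sq2 x ≤ 1 - ε → x ∈ Omega := fun x ha hb =>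
    mem_Omega.2 ⟨by linarith, by linarith⟩
  have hWW : ∀ x : E2, 0 ≤ ‖x - x₀‖ ^ (2 * β) := fun x => by positivity
  refine ⟨V', fun x => tau ε (sq2 x) * u x, fun x => tau ε (sq2 x) * ‖x - x₀‖ ^ (2 * β),
    ?_, ?_⟩
  · refine ⟨hε, hε2, hx₀, hV'L, ?_, cut_cd hε le_rfl fun x hx => cda_of_sol h1 hx, ?_,
      cut_cd hε (by norm_num) fun x hx => weight_cd β (hneq x hx),
      fun x => mul_nonneg (tau_nn _ _) (hWW x), ?_, ?_, ?_, ?_⟩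
    · intro x hxa hxb
      have := subset_closure (hreg x hxa hxb)
      rw [← hV'e this]
      exact hV x this
    · intro x
      by_cases hx : x ∈ Omega
      · exact mul_nonneg (tau_nn _ _) (hnn x (subset_closure hx))
      · change 0 ≤ tau ε (sq2 x) * u x
        rw [tau_zero hε, zero_mul]
        by_contra! h
        exact hx (mem_Omega.2 ⟨by linarith [h.1], by linarith [h.2]⟩)
    · intro x hxa hxb
      exact (cut_eq hε (fun y => ‖y - x₀‖ ^ (2 * β)) hxa hxb).eq_of_nhds
    · intro x hxa hxb
      have he := cut_eq hε (fun y => ‖y - x₀‖ ^ (2 * β)) hxa hxb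
      have hv : tau ε (sq2 x) * ‖x - x₀‖ ^ (2 * β) = ‖x - x₀‖ ^ (2 * β) := he.eq_of_nhds
      rw [Dd_congr he, Dd_congr he, hv]
      exact weight_euler β (hneq x (hreg x hxa hxb))
    · intro x hxa hxb
      have hxO := hreg x hxa hxb
      have he := cut_eq hε (fun y => ‖y - x₀‖ ^ (2 * β)) hxa hxb
      have hv : tau ε (sq2 x) * ‖x - x₀‖ ^ (2 * β) = ‖x - x₀‖ ^ (2 * β) := he.eq_of_nhds
      have heu := cut_eq hε u hxa hxb
      have hvu : tau ε (sq2 x) * u x = u x := heu.eq_of_nhds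
      rw [Dd_congr (Dd_congr_ev heu 0), Dd_congr (Dd_congr_ev heu 1), hv, hvu,
        ← hV'e (subset_closure hxO), ← h3 x hxO, lap_eq (cda_of_sol h1 hxO)]
      ring
    · intro x hxa hxb hor
      have hxO := hreg x hxa hxb
      have heu := cut_eq hε u hxa hxb
      rw [Dd_congr heu, Dd_congr heu]
      exact hPhi x hxO (hor.imp (fun h => by linarith) (fun h => by linarith))
  · intro x hx
    exact (cut_eq hε u (by linarith [hx.1]) (by linarith [hx.2])).eq_of_nhds

open Filter Topology in
lemma final_bound (β a b : ℝ) (hβ : -(1/2) < β) (ha : 0 < a) (hab : a ≤ b) :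
    ∃ c > (0:ℝ), ∀ (x₀ : E2), ‖x₀‖ = 1/2 →
      ∀ V u : E2 → ℝ,
        LipschitzOnWith (Real.toNNReal ((β + 1) * a / 2)) V (closure Omega) →
        (∀ x ∈ closure Omega, a ≤ V x ∧ V x ≤ b) →
        IsSolPbeta β x₀ V u →
        ∫ x in Omega, ‖x - x₀‖ ^ (2 * β) * Real.exp (u x) ≤ c := by
  obtain ⟨C, hC, hb⟩ := setup_bound β a b (by linarith) ha hab
  refine ⟨C, hC, fun x₀ hx V u hL hV hu => ?_⟩
  have hx₀ : sq2 x₀ = 1 / 4 := by rw [← sq2_eq, hx]; norm_num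
  by_cases hint : IntegrableOn (fun x => ‖x - x₀‖ ^ (2 * β) * Real.exp (u x)) Omega
  swap
  · rw [integral_undef hint]; exact hC.le
  obtain ⟨δ, hδ, hS⟩ := setup_of_sol hx₀ ha hL hV hu
  have hpos : ∀ n : ℕ, (0:ℝ) < 1 / ((n:ℝ) + 1) := fun n => by positivity
  have hlim : Tendsto (fun n : ℕ => 1 / ((n:ℝ) + 1)) atTop (𝓝 0) :=
    tendsto_one_div_add_atTop_nhds_zero_nat
  have hmono : Monotone (fun n : ℕ => core (1 / ((n:ℝ) + 1))) := by
    intro m n hmn x hx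
    have : 1 / ((n:ℝ) + 1) ≤ 1 / ((m:ℝ) + 1) := by
      apply one_div_le_one_div_of_le (by positivity); gcongr
    exact ⟨by linarith [hx.1], by linarith [hx.2]⟩
  have hU : (⋃ n : ℕ, core (1 / ((n:ℝ) + 1))) = Omega := by
    ext x
    rw [Set.mem_iUnion, mem_Omega]
    constructor
    · rintro ⟨n, hx⟩
      exact ⟨by linarith [hx.1, hpos n], by linarith [hx.2, hpos n]⟩
    · rintro ⟨h1, h2⟩
      have hp : 0 < min ((sq2 x - 1 / 4) / 2) ((1 - sq2 x) / 2) :=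
        lt_min (by linarith) (by linarith)
      obtain ⟨n, hn⟩ := (hlim.eventually (gt_mem_nhds hp)).exists
      have h3 := hn.trans_le (min_le_left _ _)
      have h4 := hn.trans_le (min_le_right _ _)
      exact ⟨n, by linarith, by linarith⟩
  have ht := tendsto_setIntegral_of_monotone (μ := volume)
    (f := fun x => ‖x - x₀‖ ^ (2 * β) * Real.exp (u x))
    (fun n : ℕ => (isClosed_core (1 / ((n:ℝ) + 1))).measurableSet) hmono (by rw [hU]; exact hint)
  rw [hU] at ht
  refine le_of_tendsto ht ?_
  filter_upwards [hlim.eventually (gt_mem_nhds hδ)] with n hn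
  obtain ⟨V', U, W, hset, hUu⟩ := hS _ (hpos n) hn
  refine le_trans (le_of_eq ?_) (hb _ _ _ _ _ hset)
  apply setIntegral_congr_fun (isClosed_core _).measurableSet
  intro x hx
  simp only [hUu x hx]

/-- **Theorem 2 (volume bound for (P_β))**: there is `c > 0` depending only on `a, b, β` such
that every classical solution of (P_β), with `a ≤ V ≤ b` Lipschitz with constant
`≤ (β+1) a / 2`, satisfies `∫_Ω |x - x₀|^{2β} e^u ≤ c`. -/
theorem volume_bound_Pbeta (β a b : ℝ) (hβ : -(1/2) < β) (ha : 0 < a) (hab : a ≤ b) :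
    ∃ c > (0:ℝ), ∀ (x₀ : E2), ‖x₀‖ = 1/2 →
      ∀ V u : E2 → ℝ,
        LipschitzOnWith (Real.toNNReal ((β + 1) * a / 2)) V (closure Omega) →
        (∀ x ∈ closure Omega, a ≤ V x ∧ V x ≤ b) →
        IsSolPbeta β x₀ V u →
        ∫ x in Omega, ‖x - x₀‖ ^ (2 * β) * Real.exp (u x) ≤ c := by
  exact final_bound β a b hβ ha hab
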